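/- Let q be a power of 2 and let s ∈ O^ε_{2n}(q) (ε ∈ {+,−}) be a semisimple element. Then there exist an integer 0 ≤ m ≤ n, an integer t ≥ 0, positive integers a_1,…,a_t and k_1,…,k_t with Σ_{i=1}^t k_i a_i = n − m, signs α_1,…,α_t ∈ {+,−} and a sign ε′ ∈ {+,−} such that C_{O^ε_{2n}(q)}(s) ≅ O^{ε′}_{2m}(q) × ∏_{i=1}^t GL^{α_i}_{a_i}(q^{k_i}). -/

import Mathlib

open Matrix

section Orth

variable {F : Type} [Field F] {m : ℕ}

/-- The isometry group `O(Q)` of a quadratic form `Q` on `F^m`,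
as a subgroup of `GL (Fin m) F`. -/
def isomGroup (Q : QuadraticForm F (Fin m → F)) : Subgroup (GL (Fin m) F) where
  carrier := {g | ∀ v, Q ((g : Matrix (Fin m) (Fin m) F) *ᵥ v) = Q v}
  one_mem' := by intro v; simp
  mul_mem' := by
    intro a b ha hb v
    rw [Units.val_mul, ← Matrix.mulVec_mulVec, ha, hb]
  inv_mem' := by
    intro a ha v
    have h := ha ((↑(a⁻¹) : Matrix (Fin m) (Fin m) F) *ᵥ v)
    rw [Matrix.mulVec_mulVec, Units.mul_inv, Matrix.one_mulVec] at h
    exact h.symm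

/-- The special isometry group `SO(Q)` (isometries of determinant `1`). -/
def sisomGroup (Q : QuadraticForm F (Fin m → F)) : Subgroup (GL (Fin m) F) :=
  isomGroup Q ⊓ (Matrix.GeneralLinearGroup.det : GL (Fin m) F →* Fˣ).ker

/-- Nondegeneracy of a quadratic form: no nonzero singular vector is in the radical of the
polar form. -/
def IsNondegQF (Q : QuadraticForm F (Fin m → F)) : Prop :=
  ∀ v, (∀ w, QuadraticMap.polar ⇑Q v w = 0) → Q v = 0 → v = 0

/-- `Q` has Witt index `w`: `w` is the largest dimension of a totally singular subspace. -/
def HasWittIndex (Q : QuadraticForm F (Fin m → F)) (w : ℕ) : Prop :=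
  IsGreatest {d : ℕ | ∃ W : Submodule F (Fin m → F),
    (∀ x ∈ W, Q x = 0) ∧ Module.finrank F ↥W = d} w

end Orth

/-- The fixed-point subgroup of a group endomorphism. -/
def MonoidHom.fixedSubgroup {G : Type*} [Group G] (f : G →* G) : Subgroup G where
  carrier := {g | f g = g}
  one_mem' := map_one f
  mul_mem' := by
    intro a b ha hb
    simp only [Set.mem_setOf_eq, _root_.map_mul] at *
    rw [ha, hb]
  inv_mem' := by
    intro a ha
    simp only [Set.mem_setOf_eq, _root_.map_inv] at *
    rw [ha]

/-- The group endomorphism `g ↦ (g⁻¹)ᵀ` of `GL n K`. -/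
def transposeInvHom (n K : Type*) [Fintype n] [DecidableEq n] [CommRing K] :
    GL n K →* GL n K where
  toFun g := ⟨(↑g⁻¹ : Matrix n n K)ᵀ, (↑g : Matrix n n K)ᵀ,
    by rw [← Matrix.transpose_mul, Units.mul_inv, Matrix.transpose_one],
    by rw [← Matrix.transpose_mul, Units.inv_mul, Matrix.transpose_one]⟩
  map_one' := by
    apply Units.ext
    show ((↑(1 : GL n K)⁻¹ : Matrix n n K))ᵀ = (1 : Matrix n n K)
    simp
  map_mul' a b := by
    apply Units.ext
    show ((↑(a * b)⁻¹ : Matrix n n K))ᵀ =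
      (↑a⁻¹ : Matrix n n K)ᵀ * (↑b⁻¹ : Matrix n n K)ᵀ
    rw [_root_.mul_inv_rev, Units.val_mul, Matrix.transpose_mul]

/-- The ring endomorphism `x ↦ x ^ (p ^ e)` of a commutative ring of characteristic `p`. -/
noncomputable def frobPow (K : Type*) [CommRing K] (p e : ℕ) [Fact p.Prime] [CharP K p] :
    K →+* K := iterateFrobenius K p e

/-- The general unitary group `GU_a(p^e)`: the subgroup of `GL a K` for `K = F_{p^{2e}}`
consisting of the isometries of the standard nondegenerate Hermitian form on `K^a`, the
conjugation being `x ↦ x ^ (p ^ e)`.  (It is realized as the fixed-point subgroup of the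
endomorphism `g ↦ ((g^σ)⁻¹)ᵀ` of `GL a K`, where `σ` is the entrywise conjugation.) -/
noncomputable def GUGroup (a p e : ℕ) [Fact p.Prime] :
    Subgroup (GL (Fin a) (GaloisField p (2 * e))) :=
  MonoidHom.fixedSubgroup
    ((transposeInvHom (Fin a) (GaloisField p (2 * e))).comp
      (Units.map (RingHom.mapMatrix (frobPow (GaloisField p (2 * e)) p e)).toMonoidHom))

/-- `GLsign p true a e` is `GL_a(p^e)` and `GLsign p false a e` is `GU_a(p^e)`;
this is the group denoted `GL^{α}_a(p^e)` with `α = ±`. -/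
noncomputable def GLsign (p : ℕ) [Fact p.Prime] : Bool → ℕ → ℕ → Type
  | true, a, e => GL (Fin a) (GaloisField p e)
  | false, a, e => ↥(GUGroup a p e)

noncomputable instance (p : ℕ) [Fact p.Prime] (α : Bool) (a e : ℕ) :
    Group (GLsign p α a e) := by
  cases α
  · exact inferInstanceAs (Group ↥(GUGroup a p e))
  · exact inferInstanceAs (Group (GL (Fin a) (GaloisField p e)))

section Isotropic

variable {F V : Type*} [Field F] [AddCommGroup V] [Module F V] [FiniteDimensional F V]

/-- A proper totally isotropic subspace `L` of an alternating space with `L ≠ L^⊥` extends to a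
totally isotropic subspace of larger dimension; hence a maximal one is its own orthogonal. -/
theorem exists_isotropic_eq_orthogonal (B : LinearMap.BilinForm F V) (hB : B.IsAlt) :
    ∃ L : Submodule F V, B.orthogonal L = L := by
  obtain ⟨L, hL, hmax⟩ := (wellFounded_gt (α := Submodule F V)).has_min
    {L : Submodule F V | L ≤ B.orthogonal L} ⟨⊥, show (⊥ : Submodule F V) ≤ _ from bot_le⟩
  refine ⟨L, le_antisymm (fun v hv => ?_) hL⟩
  by_contra hvL
  refine hmax (L ⊔ Submodule.span F {v}) ?_ ?_
  · intro x hx y hy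
    obtain ⟨a, ha, b, hb, rfl⟩ := Submodule.mem_sup.1 hx
    obtain ⟨c, hc, d, hd, rfl⟩ := Submodule.mem_sup.1 hy
    obtain ⟨b, rfl⟩ := Submodule.mem_span_singleton.1 hb
    obtain ⟨d, rfl⟩ := Submodule.mem_span_singleton.1 hd
    have h1 : B c a = 0 := hL ha c hc
    have h2 : B c v = 0 := hv c hc
    have h3 : B v a = 0 := (hB.eq_iff).1 (hv a ha)
    have h4 : B v v = 0 := hB v
    simp [h1, h2, h3, h4]
  · refine lt_of_le_of_ne le_sup_left fun h => hvL ?_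
    rw [h]
    exact Submodule.mem_sup_right (Submodule.mem_span_singleton_self v)

/-- The rank of an alternating form is even. -/
theorem even_finrank_add_finrank_orthogonal_top (B : LinearMap.BilinForm F V) (hB : B.IsAlt) :
    Even (Module.finrank F V + Module.finrank F (B.orthogonal ⊤)) := by
  obtain ⟨L, hL⟩ := exists_isotropic_eq_orthogonal B hB
  have h := LinearMap.BilinForm.finrank_add_finrank_orthogonal hB.isRefl L
  have h2 : L ⊓ B.orthogonal ⊤ = B.orthogonal ⊤ := by
    refine inf_eq_right.2 ?_
    conv_rhs => rw [← hL]
    exact LinearMap.BilinForm.orthogonal_le le_top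
  rw [hL, h2] at h
  exact ⟨_, h.symm⟩

end Isotropic

section PolarForm

variable {F V : Type*} [Field F] [AddCommGroup V] [Module F V]

/-- The polar form of a quadratic form, as a bilinear form. -/
def polarForm (Q : QuadraticForm F V) : LinearMap.BilinForm F V := QuadraticMap.polarBilin Q

theorem polarForm_apply (Q : QuadraticForm F V) (u v : V) :
    polarForm Q u v = QuadraticMap.polar Q u v := rfl

end PolarForm

section QuadraticCharTwo

variable {F V : Type*} [Field F] [CharP F 2] [AddCommGroup V] [Module F V]

theorem polarForm_isAlt (Q : QuadraticForm F V) :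
    (polarForm Q).IsAlt := by
  intro v
  have h : QuadraticMap.polar Q v v = 2 • Q v := QuadraticMap.polar_self Q v
  rw [CharTwo.two_nsmul] at h
  exact h

/-- Two vectors which are orthogonal for the polar form of a quadratic form over a perfect field
of characteristic two span a singular vector. -/
theorem exists_singular_combination [Finite F] (Q : QuadraticForm F V) {x y : V}
    (hxy : QuadraticMap.polar Q x y = 0) (hy : Q y ≠ 0) : ∃ c : F, Q (x + c • y) = 0 := by
  obtain ⟨c, hc⟩ := FiniteField.isSquare_of_char_two (ringChar.eq F 2) (Q x / Q y)
  refine ⟨c, ?_⟩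
  have h := QuadraticMap.map_add Q x (c • y)
  rw [QuadraticMap.polar_smul_right, hxy, smul_zero, add_zero, QuadraticMap.map_smul, ← hc,
    smul_eq_mul, div_mul_cancel₀ _ hy, CharTwo.add_self_eq_zero] at h
  exact h

theorem finrank_polar_radical_le_one [Finite F] (Q : QuadraticForm F V)
    (hQ : ∀ v, (∀ w, QuadraticMap.polar Q v w = 0) → Q v = 0 → v = 0) :
    Module.finrank F ((polarForm Q).orthogonal ⊤) ≤ 1 := by
  have hrad : ∀ v ∈ (polarForm Q).orthogonal ⊤, ∀ w,
      QuadraticMap.polar Q v w = 0 := fun v hv w => by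
    rw [QuadraticMap.polar_comm]; exact hv w trivial
  by_cases h0 : ∃ v ∈ (polarForm Q).orthogonal ⊤, v ≠ 0
  · obtain ⟨v, hv, hv0⟩ := h0
    have hQv : Q v ≠ 0 := fun h => hv0 (hQ v (hrad v hv) h)
    refine finrank_le_one (⟨v, hv⟩ : (polarForm Q).orthogonal ⊤) fun w => ?_
    obtain ⟨c, hc⟩ := exists_singular_combination Q (hrad w w.2 v) hQv
    have h := hQ _ (hrad _ (Submodule.add_mem _ w.2 (Submodule.smul_mem _ c hv))) hc
    refine ⟨-c, Subtype.ext ?_⟩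
    simp only [neg_smul]
    exact (eq_neg_of_add_eq_zero_left h).symm
  · push Not at h0
    have : (polarForm Q).orthogonal ⊤ = ⊥ := (Submodule.eq_bot_iff _).2 h0
    rw [this]; simp

theorem polar_nondegenerate_of_even_finrank [Finite F] [FiniteDimensional F V]
    (Q : QuadraticForm F V) (hV : Even (Module.finrank F V))
    (hQ : ∀ v, (∀ w, QuadraticMap.polar Q v w = 0) → Q v = 0 → v = 0) (v : V)
    (hv : ∀ w, QuadraticMap.polar Q v w = 0) : v = 0 := by
  have h1 := finrank_polar_radical_le_one Q hQ
  have h2 := even_finrank_add_finrank_orthogonal_top _ (polarForm_isAlt Q)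
  have h3 : Module.finrank F ((polarForm Q).orthogonal ⊤) = 0 := by
    obtain ⟨a, ha⟩ := hV
    obtain ⟨b, hb⟩ := h2
    omega
  have h4 : v ∈ (polarForm Q).orthogonal ⊤ := fun w _ => by
    have := hv w
    rw [QuadraticMap.polar_comm] at this
    exact this
  rw [Submodule.finrank_eq_zero.1 h3] at h4
  simpa using h4

/-- A totally singular subspace of codimension at least two in a maximal isotropic one is not
maximal among totally singular subspaces. -/
theorem exists_larger_totally_singular [Finite F] [FiniteDimensional F V] (Q : QuadraticForm F V)
    (W : Submodule F V) (hW : ∀ x ∈ W, Q x = 0)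
    (hdim : 2 * Module.finrank F W + 2 < Module.finrank F V) :
    ∃ W' : Submodule F V, (∀ x ∈ W', Q x = 0) ∧ Module.finrank F W < Module.finrank F W' := by
  set B := polarForm Q
  have hrefl : B.IsRefl := (polarForm_isAlt Q).isRefl
  have key : ∀ x, x ∉ W → (∀ w ∈ W, QuadraticMap.polar Q w x = 0) → Q x = 0 →
      ∃ W' : Submodule F V, (∀ x ∈ W', Q x = 0) ∧ Module.finrank F W < Module.finrank F W' := by
    intro x hx hWx hQx
    refine ⟨W ⊔ Submodule.span F {x}, ?_, ?_⟩
    · intro y hy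
      obtain ⟨a, ha, b, hb, rfl⟩ := Submodule.mem_sup.1 hy
      obtain ⟨b, rfl⟩ := Submodule.mem_span_singleton.1 hb
      rw [QuadraticMap.map_add Q, QuadraticMap.polar_smul_right, hWx a ha, hW a ha,
        QuadraticMap.map_smul, hQx]
      simp
    · refine Submodule.finrank_lt_finrank_of_lt (lt_of_le_of_ne le_sup_left fun h => hx ?_)
      rw [h]
      exact Submodule.mem_sup_right (Submodule.mem_span_singleton_self x)
  have hd : ∀ U : Submodule F V,
      Module.finrank F V ≤ Module.finrank F U + Module.finrank F (B.orthogonal U) := fun U => by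
    have := LinearMap.BilinForm.finrank_add_finrank_orthogonal hrefl U
    omega
  have hex : ∀ U U' : Submodule F V, Module.finrank F U < Module.finrank F U' →
      ∃ x ∈ U', x ∉ U := by
    intro U U' h
    by_contra! hc
    exact absurd (Submodule.finrank_mono (show U' ≤ U from hc)) (by omega)
  obtain ⟨v, hv, hvW⟩ := hex W (B.orthogonal W) (by have := hd W; omega)
  have hsp : Module.finrank F (W ⊔ Submodule.span F {v} : Submodule F V) ≤
      Module.finrank F W + 1 := by
    have h1 := Submodule.finrank_add_le_finrank_add_finrank W (Submodule.span F {v})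
    have h2 := finrank_span_le_card (R := F) ({v} : Set V)
    simp only [Set.toFinset_singleton, Finset.card_singleton] at h2
    omega
  obtain ⟨y, hy, hyW⟩ := hex (W ⊔ Submodule.span F {v})
    (B.orthogonal (W ⊔ Submodule.span F {v})) (by
      have := hd (W ⊔ Submodule.span F {v}); omega)
  have hWy : ∀ w ∈ W, QuadraticMap.polar Q w y = 0 := fun w hw =>
    hy w (Submodule.mem_sup_left hw)
  have hvy : QuadraticMap.polar Q v y = 0 :=
    hy v (Submodule.mem_sup_right (Submodule.mem_span_singleton_self v))
  by_cases hQy : Q y = 0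
  · exact key y (fun h => hyW (Submodule.mem_sup_left h)) hWy hQy
  · obtain ⟨c, hc⟩ := exists_singular_combination Q hvy hQy
    refine key _ (fun h => ?_) (fun w hw => ?_) hc
    · by_cases hc0 : c = 0
      · rw [hc0, zero_smul, add_zero] at h
        exact hvW h
      · apply hyW
        have h1 : c • y ∈ W ⊔ Submodule.span F {v} := by
          have := Submodule.sub_mem (W ⊔ Submodule.span F {v}) (Submodule.mem_sup_left h)
            (Submodule.mem_sup_right (Submodule.mem_span_singleton_self v))
          simpa using this
        exact (Submodule.smul_mem_iff _ hc0).1 h1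
    · rw [QuadraticMap.polar_add_right, QuadraticMap.polar_smul_right, hWy w hw]
      simpa using (show QuadraticMap.polar Q w v = 0 from hv w hw)

theorem finrank_le_of_totally_singular [FiniteDimensional F V] (Q : QuadraticForm F V)
    (hQ : ∀ v, (∀ w, QuadraticMap.polar Q v w = 0) → v = 0) (W : Submodule F V)
    (hW : ∀ x ∈ W, Q x = 0) : 2 * Module.finrank F W ≤ Module.finrank F V := by
  set B := polarForm Q
  have hrefl : B.IsRefl := (polarForm_isAlt Q).isRefl
  have h := LinearMap.BilinForm.finrank_add_finrank_orthogonal hrefl W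
  have h1 : W ≤ B.orthogonal W := fun x hx y hy => by
    change QuadraticMap.polar Q y x = 0
    simp [QuadraticMap.polar, hW _ (W.add_mem hy hx), hW x hx, hW y hy]
  have h2 : B.orthogonal ⊤ = ⊥ := (Submodule.eq_bot_iff _).2 fun v hv => hQ v fun w => by
    rw [QuadraticMap.polar_comm]; exact hv w trivial
  have h3 := Submodule.finrank_mono h1
  rw [h2, inf_bot_eq, finrank_bot] at h
  omega

end QuadraticCharTwo

theorem exists_hasWittIndex {F : Type} [Field F] [CharP F 2] [Finite F] {m : ℕ}
    (Q : QuadraticForm F (Fin (2 * m) → F))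
    (hQ : ∀ v, (∀ w, QuadraticMap.polar Q v w = 0) → v = 0) :
    ∃ ε : Bool, HasWittIndex Q (if ε then m else m - 1) := by
  let S : Set ℕ := {d : ℕ | ∃ W : Submodule F (Fin (2 * m) → F),
    (∀ x ∈ W, Q x = 0) ∧ Module.finrank F W = d}
  have hbd : ∀ d ∈ S, d ≤ m := by
    rintro d ⟨W, hW, rfl⟩
    have := finrank_le_of_totally_singular Q hQ W hW
    rw [Module.finrank_fin_fun] at this
    omega
  obtain ⟨w, ⟨W, hW, hw⟩, hmax⟩ : ∃ w, IsGreatest S w :=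
    ⟨_, Nat.sSup_mem ⟨0, ⊥, by simp, by simp⟩ ⟨m, hbd⟩,
      fun d hd => le_csSup ⟨m, hbd⟩ hd⟩
  have h1 : w ≤ m := hbd w ⟨W, hW, hw⟩
  have h2 : ¬ (2 * w + 2 < 2 * m) := fun h => by
    obtain ⟨W', hW', hlt⟩ := exists_larger_totally_singular Q W hW
      (by rw [Module.finrank_fin_fun, hw]; exact h)
    have := hmax ⟨W', hW', rfl⟩
    omega
  have hG : HasWittIndex Q w := ⟨⟨W, hW, hw⟩, hmax⟩
  by_cases hwm : w = m
  · exact ⟨true, by simpa [hwm] using hG⟩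
  · refine ⟨false, ?_⟩
    have : w = m - 1 := by omega
    simpa [this] using hG

section Centralizers

variable {F V : Type*} [Field F] [AddCommGroup V] [Module F V]

/-- The endomorphisms commuting with `s` and preserving the bilinear form `B`. -/
def bilinCentralizer (B : LinearMap.BilinForm F V) (s : Module.End F V) :
    Submonoid (Module.End F V) where
  carrier := {g | (∀ u v, B (g u) (g v) = B u v) ∧ ∀ v, g (s v) = s (g v)}
  one_mem' := by simp
  mul_mem' := by
    rintro a b ⟨ha, ha'⟩ ⟨hb, hb'⟩
    exact ⟨fun u v => by rw [Module.End.mul_apply, Module.End.mul_apply, ha, hb],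
      fun v => by rw [Module.End.mul_apply, Module.End.mul_apply, hb', ha']⟩

theorem mem_bilinCentralizer {B : LinearMap.BilinForm F V} {s g : Module.End F V} :
    g ∈ bilinCentralizer B s ↔ (∀ u v, B (g u) (g v) = B u v) ∧ ∀ v, g (s v) = s (g v) :=
  Iff.rfl

/-- The endomorphisms commuting with `s` and preserving the quadratic form `Q`. -/
def quadCentralizer (Q : QuadraticForm F V) (s : Module.End F V) :
    Submonoid (Module.End F V) where
  carrier := {g | (∀ v, Q (g v) = Q v) ∧ ∀ v, g (s v) = s (g v)}
  one_mem' := by simp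
  mul_mem' := by
    rintro a b ⟨ha, ha'⟩ ⟨hb, hb'⟩
    exact ⟨fun v => by rw [Module.End.mul_apply, ha, hb],
      fun v => by rw [Module.End.mul_apply, Module.End.mul_apply, hb', ha']⟩

theorem mem_quadCentralizer {Q : QuadraticForm F V} {s g : Module.End F V} :
    g ∈ quadCentralizer Q s ↔ (∀ v, Q (g v) = Q v) ∧ ∀ v, g (s v) = s (g v) :=
  Iff.rfl

/-- The injective endomorphisms commuting with `s`. -/
def injCentralizer (s : Module.End F V) : Submonoid (Module.End F V) where
  carrier := {g | Function.Injective g ∧ ∀ v, g (s v) = s (g v)}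
  one_mem' := ⟨Function.injective_id, fun _ => rfl⟩
  mul_mem' := by
    rintro a b ⟨ha, ha'⟩ ⟨hb, hb'⟩
    exact ⟨ha.comp hb, fun v => by rw [Module.End.mul_apply, Module.End.mul_apply, hb', ha']⟩

theorem mem_injCentralizer {s g : Module.End F V} :
    g ∈ injCentralizer s ↔ Function.Injective g ∧ ∀ v, g (s v) = s (g v) :=
  Iff.rfl

theorem injective_of_mem_bilinCentralizer {B : LinearMap.BilinForm F V}
    (hB : ∀ v, (∀ w, B v w = 0) → v = 0) {s g : Module.End F V}
    (hg : g ∈ bilinCentralizer B s) : Function.Injective g := by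
  refine (injective_iff_map_eq_zero g).2 fun v hv => hB v fun w => ?_
  rw [← hg.1, hv, map_zero, LinearMap.zero_apply]

theorem nonempty_mulEquiv_of_range {G M : Type*} [Group G] [Monoid M] (φ : G →* M)
    (hφ : Function.Injective φ) (S : Submonoid M) (hS : ∀ x, x ∈ S ↔ ∃ g, φ g = x) :
    Nonempty (S ≃* G) :=
  ⟨(MulEquiv.ofBijective (φ.codRestrict S fun g => (hS _).2 ⟨g, rfl⟩)
    ⟨fun _ _ h => hφ (congrArg Subtype.val h), fun x => by
      obtain ⟨g, hg⟩ := (hS x).1 x.2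
      exact ⟨g, Subtype.ext hg⟩⟩).symm⟩

/-- A submonoid of block diagonal endomorphisms, described blockwise, is a product. -/
theorem nonempty_mulEquiv_prod_of_isCompl {W₁ W₂ : Submodule F V} (hW : IsCompl W₁ W₂)
    (S : Submonoid (Module.End F V)) (S₁ : Submonoid (Module.End F W₁))
    (S₂ : Submonoid (Module.End F W₂))
    (h₁ : ∀ g ∈ S, ∀ x ∈ W₁, g x ∈ W₁) (h₂ : ∀ g ∈ S, ∀ x ∈ W₂, g x ∈ W₂)
    (hS : ∀ (g : Module.End F V) (hg₁ : ∀ x ∈ W₁, g x ∈ W₁) (hg₂ : ∀ x ∈ W₂, g x ∈ W₂),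
      g ∈ S ↔ g.restrict hg₁ ∈ S₁ ∧ g.restrict hg₂ ∈ S₂) :
    Nonempty (S ≃* S₁ × S₂) := by
  let φ : S →* S₁ × S₂ :=
    { toFun g := (⟨g.1.restrict (h₁ g g.2), ((hS g (h₁ g g.2) (h₂ g g.2)).1 g.2).1⟩,
        ⟨g.1.restrict (h₂ g g.2), ((hS g (h₁ g g.2) (h₂ g g.2)).1 g.2).2⟩)
      map_one' := rfl
      map_mul' _ _ := rfl }
  refine ⟨MulEquiv.ofBijective φ ⟨fun g g' h => ?_, ?_⟩⟩
  · apply Subtype.ext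
    ext v
    obtain ⟨x, hx, y, hy, rfl⟩ := Submodule.mem_sup.1
      (show v ∈ W₁ ⊔ W₂ by rw [hW.sup_eq_top]; trivial)
    have e₁ := congrArg (fun k : S₁ × S₂ => ((k.1.1 ⟨x, hx⟩ : W₁) : V)) h
    have e₂ := congrArg (fun k : S₁ × S₂ => ((k.2.1 ⟨y, hy⟩ : W₂) : V)) h
    change g.1 x = g'.1 x at e₁
    change g.1 y = g'.1 y at e₂
    rw [map_add, map_add, e₁, e₂]
  · rintro ⟨⟨g₁, hg₁⟩, ⟨g₂, hg₂⟩⟩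
    let g : Module.End F V := LinearMap.ofIsCompl hW (W₁.subtype ∘ₗ g₁) (W₂.subtype ∘ₗ g₂)
    have a₁ : ∀ x : W₁, g x = g₁ x := fun x => LinearMap.ofIsCompl_apply_left hW x
    have a₂ : ∀ x : W₂, g x = g₂ x := fun x => LinearMap.ofIsCompl_apply_right hW x
    have b₁ : ∀ x ∈ W₁, g x ∈ W₁ := fun x hx => by rw [a₁ ⟨x, hx⟩]; exact (g₁ _).2
    have b₂ : ∀ x ∈ W₂, g x ∈ W₂ := fun x hx => by rw [a₂ ⟨x, hx⟩]; exact (g₂ _).2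
    have c₁ : g.restrict b₁ = g₁ := LinearMap.ext fun x => Subtype.ext (a₁ x)
    have c₂ : g.restrict b₂ = g₂ := LinearMap.ext fun x => Subtype.ext (a₂ x)
    exact ⟨⟨g, (hS g b₁ b₂).2 ⟨c₁ ▸ hg₁, c₂ ▸ hg₂⟩⟩,
      Prod.ext (Subtype.ext c₁) (Subtype.ext c₂)⟩

end Centralizers

section PolynomialsInIsometry

open Polynomial

variable {F V : Type*} [Field F] [AddCommGroup V] [Module F V]

theorem aeval_pow_card_pow [Fintype F] (s : Module.End F V) (p : F[X]) (k : ℕ) :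
    (aeval s p) ^ Fintype.card F ^ k = aeval (s ^ Fintype.card F ^ k) p := by
  induction k with
  | zero => simp
  | succ k ih =>
    rw [pow_succ, pow_mul, ih, pow_mul, ← map_pow, ← FiniteField.expand_card, expand_aeval]

/-- Polynomials in an endomorphism of order prime to the characteristic of a finite field satisfy
an equation `T ^ M = T`. -/
theorem exists_aeval_pow_eq [Fintype F] {s : Module.End F V} {N : ℕ} (hs : s ^ N = 1)
    (hN : (Fintype.card F).Coprime N) :
    ∃ M, ∀ p : F[X], (aeval s p) ^ (M + 2) = aeval s p := by
  have hN0 : 0 < N := by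
    rcases Nat.eq_zero_or_pos N with rfl | h
    · have := Fintype.one_lt_card (α := F)
      rw [Nat.coprime_zero_right] at hN
      omega
    · exact h
  have h1 : 1 < Fintype.card F ^ N.totient :=
    Nat.one_lt_pow (Nat.totient_pos.2 hN0).ne' Fintype.one_lt_card
  obtain ⟨M, hM⟩ := Nat.exists_eq_add_of_le' h1
  refine ⟨M, fun p => ?_⟩
  have h2 : s ^ Fintype.card F ^ N.totient = s := by
    have h3 := Nat.ModEq.pow_totient hN
    obtain ⟨c, hc⟩ := (Nat.modEq_iff_dvd' h1.le).1 h3.symm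
    rw [show Fintype.card F ^ N.totient = N * c + 1 by omega, pow_succ, pow_mul, hs]
    simp
  have h4 := aeval_pow_card_pow s p N.totient
  rw [h2, hM] at h4
  exact h4

theorem aeval_eq_zero_of_aeval_aeval_eq_zero [Fintype F] {s : Module.End F V} {N : ℕ}
    (hs : s ^ N = 1) (hN : (Fintype.card F).Coprime N) (p : F[X]) (v : V)
    (hv : aeval s p (aeval s p v) = 0) : aeval s p v = 0 := by
  obtain ⟨M, hM⟩ := exists_aeval_pow_eq hs hN
  have h := congrArg (fun T : Module.End F V => T v) (hM p)
  simp only [pow_add, Module.End.mul_apply, pow_two, hv, map_zero] at h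
  exact h.symm

theorem isCompl_ker_range_aeval [Fintype F] [FiniteDimensional F V] {s : Module.End F V} {N : ℕ}
    (hs : s ^ N = 1) (hN : (Fintype.card F).Coprime N) (p : F[X]) :
    IsCompl (LinearMap.ker (aeval s p)) (LinearMap.range (aeval s p)) := by
  have h := LinearMap.finrank_range_add_finrank_ker (aeval s p)
  refine (Submodule.isCompl_iff_disjoint _ _ (by omega)).2 (Submodule.disjoint_def.2 ?_)
  rintro _ hx ⟨v, rfl⟩
  exact aeval_eq_zero_of_aeval_aeval_eq_zero hs hN p v hx

theorem bilin_aeval_left {B : LinearMap.BilinForm F V} {s s' : Module.End F V}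
    (hB : ∀ u v, B (s u) (s v) = B u v) (hs' : s * s' = 1) (p : F[X]) (u v : V) :
    B (aeval s p u) v = B u (aeval s' p v) := by
  have h1 : ∀ u v, B (s u) v = B u (s' v) := fun u v => by
    rw [← hB u (s' v), ← Module.End.mul_apply, hs', Module.End.one_apply]
  induction p using Polynomial.induction_on' generalizing u v with
  | add p q hp hq => simp [hp, hq]
  | monomial n a =>
    rw [aeval_monomial, aeval_monomial]
    simp only [Module.End.mul_apply, Module.algebraMap_end_apply, map_smul, LinearMap.smul_apply]
    congr 1
    induction n generalizing u v with
    | zero => simp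
    | succ n ih =>
      rw [pow_succ, pow_succ', Module.End.mul_apply, Module.End.mul_apply, ih, h1]

theorem commute_aeval_apply {s g : Module.End F V} (hg : ∀ v, g (s v) = s (g v)) (p : F[X])
    (v : V) : g (aeval s p v) = aeval s p (g v) := by
  have h1 : Commute g s := LinearMap.ext hg
  have h2 : Commute g (aeval s p) := by
    induction p using Polynomial.induction_on' with
    | add p q hp hq => rw [map_add]; exact hp.add_right hq
    | monomial n a =>
      rw [aeval_monomial]
      exact (Algebra.commute_algebraMap_right a g).mul_right (h1.pow_right n)
  exact congrArg (fun T : Module.End F V => T v) h2.eq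

theorem restrict_aeval_apply {s : Module.End F V} {W : Submodule F V}
    (hW : ∀ x ∈ W, s x ∈ W) (p : F[X]) (x : W) :
    (aeval (s.restrict hW) p x : V) = aeval s p x := by
  induction p using Polynomial.induction_on' generalizing x with
  | add p q hp hq => simp [hp, hq]
  | monomial n a =>
    rw [aeval_monomial, aeval_monomial]
    simp only [Module.End.mul_apply, Module.algebraMap_end_apply, Submodule.coe_smul]
    congr 1
    rw [Module.End.pow_restrict]
    rfl

end PolynomialsInIsometry

section LinearGroups

variable {F K K' V : Type*} [Field F] [Field K] [Field K'] [Algebra F K] [AddCommGroup V]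
  [Module F V] [Module K V] [IsScalarTower F K V] {a : ℕ}

/-- Matrices over a field `K'` identified with `K` act on a `K`-space with a given basis. -/
noncomputable def glToEnd (b : Module.Basis (Fin a) K V) (σ : K' ≃+* K) :
    GL (Fin a) K' →* Module.End F V where
  toFun A := (Matrix.toLin b b ((A : Matrix (Fin a) (Fin a) K').map σ)).restrictScalars F
  map_one' := by
    have h : ((1 : Matrix (Fin a) (Fin a) K').map σ) = 1 := by
      rw [Matrix.map_one _ (map_zero σ) (map_one σ)]
    ext v
    simp [h]
  map_mul' A A' := by
    ext v
    simp [Matrix.map_mul, Matrix.toLin_mul b b b]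

theorem glToEnd_apply (b : Module.Basis (Fin a) K V) (σ : K' ≃+* K) (A : GL (Fin a) K') (v : V) :
    glToEnd (F := F) b σ A v =
      Matrix.toLin b b ((A : Matrix (Fin a) (Fin a) K').map σ) v := rfl

theorem glToEnd_smul (b : Module.Basis (Fin a) K V) (σ : K' ≃+* K) (A : GL (Fin a) K') (x : K)
    (v : V) : glToEnd (F := F) b σ A (x • v) = x • glToEnd (F := F) b σ A v := by
  simp only [glToEnd_apply, map_smul]

theorem glToEnd_basis (b : Module.Basis (Fin a) K V) (σ : K' ≃+* K) (A : GL (Fin a) K')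
    (j : Fin a) : glToEnd (F := F) b σ A (b j) = ∑ i, σ (A.1 i j) • b i := by
  rw [glToEnd_apply, Matrix.toLin_self]
  rfl

theorem glToEnd_injective (b : Module.Basis (Fin a) K V) (σ : K' ≃+* K) :
    Function.Injective (glToEnd (F := F) b σ) := by
  intro A A' h
  have h1 : Matrix.toLin b b ((A : Matrix (Fin a) (Fin a) K').map σ) =
      Matrix.toLin b b ((A' : Matrix (Fin a) (Fin a) K').map σ) :=
    LinearMap.ext fun v => congrArg (fun T : Module.End F V => T v) h
  exact Units.ext (Matrix.map_injective σ.injective ((Matrix.toLin b b).injective h1))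

theorem exists_glToEnd_eq_iff (b : Module.Basis (Fin a) K V) (σ : K' ≃+* K)
    (g : Module.End F V) :
    (∃ A, glToEnd (F := F) b σ A = g) ↔
      Function.Injective g ∧ ∀ (x : K) (v : V), g (x • v) = x • g v := by
  constructor
  · rintro ⟨A, rfl⟩
    refine ⟨Function.LeftInverse.injective (g := glToEnd (F := F) b σ A⁻¹) fun v => ?_,
      glToEnd_smul b σ A⟩
    rw [← Module.End.mul_apply, ← map_mul, inv_mul_cancel, map_one, Module.End.one_apply]
  · rintro ⟨hinj, hK⟩
    have : FiniteDimensional K V := Module.Basis.finiteDimensional_of_finite b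
    let gK : V →ₗ[K] V := { toFun := g, map_add' := map_add g, map_smul' := hK }
    let e : V ≃ₗ[K] V := LinearEquiv.ofInjectiveEndo gK hinj
    have he : ∀ v, e v = g v := fun v => rfl
    let toMat : (V →ₗ[K] V) →* Matrix (Fin a) (Fin a) K' :=
      (RingEquiv.mapMatrix (m := Fin a) σ.symm).toRingHom.toMonoidHom.comp
        (LinearMap.toMatrixAlgEquiv b).toRingEquiv.toRingHom.toMonoidHom
    refine ⟨Units.map toMat ((LinearMap.GeneralLinearGroup.generalLinearEquiv K V).symm e), ?_⟩
    ext v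
    rw [glToEnd_apply]
    have h : ((Units.map toMat ((LinearMap.GeneralLinearGroup.generalLinearEquiv K V).symm e) :
        GL (Fin a) K') : Matrix (Fin a) (Fin a) K').map σ = LinearMap.toMatrix b b e := by
      ext i j
      exact σ.apply_symm_apply _
    rw [h, Matrix.toLin_toMatrix]
    rfl

theorem commutes_iff_smul_of_adjoin_eq_top {x₀ : K}
    (hx₀ : Algebra.adjoin F {x₀} = ⊤) {s : Module.End F V} (hs : ∀ v, s v = x₀ • v)
    (g : Module.End F V) :
    (∀ v, g (s v) = s (g v)) ↔ ∀ (x : K) (v : V), g (x • v) = x • g v := by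
  refine ⟨fun h x => ?_, fun h v => by rw [hs, hs, h]⟩
  have hx : x ∈ Algebra.adjoin F {x₀} := by rw [hx₀]; trivial
  induction hx using Algebra.adjoin_induction with
  | mem y hy =>
    intro v
    rw [Set.mem_singleton_iff] at hy
    rw [hy, ← hs, h, hs]
  | algebraMap r => intro v; simp only [algebraMap_smul, map_smul]
  | add y z _ _ hy hz => intro v; rw [add_smul, add_smul, map_add, hy, hz]
  | mul y z _ _ hy hz => intro v; rw [mul_smul, mul_smul, hy, hz]

end LinearGroups

section FiniteFieldIsomorphisms

/-- A finite field of the right cardinality is a Galois field. -/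
theorem nonempty_galoisField_ringEquiv {K : Type*} [Field K] [Finite K] {p e : ℕ} [Fact p.Prime]
    (he : e ≠ 0) (hK : Nat.card K = p ^ e) : Nonempty (GaloisField p e ≃+* K) := by
  have := Fintype.ofFinite K
  have := Fintype.ofFinite (GaloisField p e)
  refine ⟨FiniteField.ringEquivOfCardEq ?_⟩
  rw [← Nat.card_eq_fintype_card, ← Nat.card_eq_fintype_card, hK, GaloisField.card p e he]

/-- An involution of a finite extension `K / F` of finite fields is the map
`x ↦ x ^ (|F| ^ k)`, with `[K : F] = 2 k`. -/
theorem exists_involution_eq_pow {F K : Type*} [Field F] [Fintype F] [Field K] [Finite K]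
    [Algebra F K] (τ : K ≃ₐ[F] K) (hτ : ∀ x, τ (τ x) = x) (hτ1 : ∃ x, τ x ≠ x) :
    ∃ k, 0 < k ∧ Module.finrank F K = 2 * k ∧ ∀ x, τ x = x ^ Fintype.card F ^ k := by
  obtain ⟨n, hn⟩ := (FiniteField.bijective_frobeniusAlgEquivOfAlgebraic_pow F K).2 τ
  have h2 : FiniteField.frobeniusAlgEquivOfAlgebraic F K ^ (2 * (n : ℕ)) = 1 := by
    rw [two_mul, pow_add]
    simp only at hn
    rw [hn]
    ext x
    exact hτ x
  have h3 := orderOf_dvd_of_pow_eq_one h2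
  rw [FiniteField.orderOf_frobeniusAlgEquivOfAlgebraic] at h3
  have hn0 : (n : ℕ) ≠ 0 := fun h => by
    obtain ⟨x, hx⟩ := hτ1
    apply hx
    rw [← hn]
    simp [h]
  have hn1 := n.2
  refine ⟨n, Nat.pos_of_ne_zero hn0, ?_, fun x => ?_⟩
  · obtain ⟨c, hc⟩ := h3
    have hc1 : c = 1 := by
      have h4 : c ≠ 0 := by rintro rfl; omega
      have h5 : c < 2 := by
        by_contra! h
        have := Nat.mul_le_mul_left (Module.finrank F K) h
        omega
      omega
    rw [hc, hc1, mul_one]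
  · rw [← hn]
    change (FiniteField.frobeniusAlgEquivOfAlgebraic F K ^ (n : ℕ)) x = _
    rw [AlgEquiv.coe_pow, FiniteField.coe_frobeniusAlgEquivOfAlgebraic_iterate]

end FiniteFieldIsomorphisms

section Hermitian

variable {K V : Type*} [Field K] [AddCommGroup V] [Module K V]

theorem sesq_sum_smul {ι : Type*} {τ : K →+* K} {H : V → V →ₗ[K] K}
    (hH : ∀ u v, H v u = τ (H u v)) (t : Finset ι) (c : ι → K) (w : ι → V) (u : V) :
    H (∑ i ∈ t, c i • w i) u = ∑ i ∈ t, τ (c i) * H (w i) u := by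
  rw [hH u, map_sum, map_sum]
  refine Finset.sum_congr rfl fun i _ => ?_
  rw [map_smul, smul_eq_mul, map_mul, ← hH]

theorem sesq_sub_smul_add {τ : K →+* K} {H : V → V →ₗ[K] K}
    (hH : ∀ u v, H v u = τ (H u v)) (c : K) (v w u : V) :
    H (c • v + w) u = τ c * H v u + H w u := by
  rw [hH u, map_add, map_add, map_smul, smul_eq_mul, map_mul, ← hH, ← hH]

/-- An orthonormal family for a Hermitian form which does not span extends by one vector. -/
theorem exists_orthonormal_extension [Finite K] [CharP K 2] (τ : K →+* K)
    (hτ1 : ∃ x, τ x ≠ x) (H : V → V →ₗ[K] K) (hH : ∀ u v, H v u = τ (H u v))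
    (hnd : ∀ v, (∀ u, H v u = 0) → v = 0) {a : ℕ} (b : Fin a → V)
    (hb : ∀ i j, H (b i) (b j) = if i = j then 1 else 0)
    (hspan : Submodule.span K (Set.range b) ≠ ⊤) :
    ∃ w, H w w = 1 ∧ (∀ i, H (b i) w = 0) ∧ ∀ i, H w (b i) = 0 := by
  have hflip : ∀ u v, H u v = 0 → H v u = 0 := fun u v h => by rw [hH, h, map_zero]
  have hproj : ∀ v, ∀ j, H (b j) (v - ∑ i, H (b i) v • b i) = 0 := fun v j => by
    rw [map_sub, map_sum]
    simp [hb]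
  have hbad : ∃ w, H w w ≠ 0 ∧ ∀ i, H (b i) w = 0 := by
    obtain ⟨v₀, -, hv₀⟩ := SetLike.exists_of_lt (lt_top_iff_ne_top.2 hspan)
    set v := v₀ - ∑ i, H (b i) v₀ • b i with hv
    have hvb : ∀ j, H (b j) v = 0 := hproj v₀
    have hv0 : v ≠ 0 := fun h => hv₀ <| by
      rw [sub_eq_zero.1 (hv.symm.trans h)]
      exact Submodule.sum_mem _ fun i _ =>
        Submodule.smul_mem _ _ (Submodule.subset_span ⟨i, rfl⟩)
    by_cases hvv : H v v = 0
    · obtain ⟨u₀, hu₀⟩ : ∃ u, H v u ≠ 0 := by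
        by_contra! h
        exact hv0 (hnd v h)
      set u := u₀ - ∑ i, H (b i) u₀ • b i with hu
      have hub : ∀ j, H (b j) u = 0 := hproj u₀
      have hvu : H v u ≠ 0 := by
        rw [hu, map_sub, map_sum]
        simpa [hflip _ _ (hvb _)] using hu₀
      by_cases huu : H u u = 0
      · obtain ⟨θ, hθ⟩ := hτ1
        refine ⟨(θ / H u v) • v + u, ?_, fun i => by rw [map_add, map_smul, hvb, hub]; simp⟩
        have huv : H u v ≠ 0 := fun h => hvu (hflip _ _ h)
        have e1 : τ (θ / H u v) * H v u = τ θ := by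
          rw [hH u v, ← map_mul, div_mul_cancel₀ _ huv]
        rw [sesq_sub_smul_add hH, map_add, map_add, map_smul, map_smul, hvv, huu, smul_zero,
          zero_add, add_zero, e1, smul_eq_mul, div_mul_cancel₀ _ huv]
        intro h
        exact hθ (CharTwo.add_eq_zero.1 h)
      · exact ⟨u, huu, hub⟩
    · exact ⟨v, hvv, hvb⟩
  obtain ⟨w, hw, hwb⟩ := hbad
  obtain ⟨c, hc⟩ := FiniteField.isSquare_of_char_two (ringChar.eq K 2) (H w w)⁻¹
  have hτc : τ c = c := by
    have h1 : τ c ^ 2 = c ^ 2 := by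
      rw [← map_pow, pow_two, ← hc, map_inv₀, ← hH]
    rcases sq_eq_sq_iff_eq_or_eq_neg.1 h1 with h | h
    · exact h
    · rwa [CharTwo.neg_eq] at h
  have h2 : ∀ i, H (b i) (c • w) = 0 := fun i => by rw [map_smul, hwb, smul_zero]
  refine ⟨c • w, ?_, h2, fun i => hflip _ _ (h2 i)⟩
  have h3 := sesq_sub_smul_add hH c w 0 (c • w)
  rw [add_zero, hτc, hH _ 0, map_zero, map_zero, add_zero, map_smul (H w), smul_eq_mul,
    ← mul_assoc, ← hc, inv_mul_cancel₀ hw] at h3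
  exact h3

/-- A nondegenerate Hermitian form over a finite field of characteristic two has an orthonormal
basis. -/
theorem exists_orthonormal_basis [Finite K] [CharP K 2] [FiniteDimensional K V] (τ : K →+* K)
    (hτ1 : ∃ x, τ x ≠ x) (H : V → V →ₗ[K] K) (hH : ∀ u v, H v u = τ (H u v))
    (hnd : ∀ v, (∀ u, H v u = 0) → v = 0) :
    ∃ b : Module.Basis (Fin (Module.finrank K V)) K V,
      ∀ i j, H (b i) (b j) = if i = j then 1 else 0 := by
  have hli : ∀ {a : ℕ} (b : Fin a → V), (∀ i j, H (b i) (b j) = if i = j then 1 else 0) →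
      LinearIndependent K b := fun b hb => by
    refine Fintype.linearIndependent_iff.2 fun g hg i => ?_
    have h := congrArg (H (b i)) hg
    rw [map_sum, map_zero] at h
    simpa [hb] using h
  have hstep : ∀ n, n ≤ Module.finrank K V →
      ∃ b : Fin n → V, ∀ i j, H (b i) (b j) = if i = j then 1 else 0 := by
    intro n
    induction n with
    | zero => exact fun _ => ⟨Fin.elim0, fun i => i.elim0⟩
    | succ n ih =>
      intro hn
      obtain ⟨b, hb⟩ := ih (by omega)
      have hspan : Submodule.span K (Set.range b) ≠ ⊤ := fun h => by
        have h1 := finrank_span_eq_card (hli b hb)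
        rw [h, finrank_top, Fintype.card_fin] at h1
        omega
      obtain ⟨w, hw, hbw, hwb⟩ := exists_orthonormal_extension τ hτ1 H hH hnd b hb hspan
      refine ⟨Fin.cons w b, fun i j => ?_⟩
      refine Fin.cases ?_ (fun i => ?_) i <;> refine Fin.cases ?_ (fun j => ?_) j
      · simpa using hw
      · simpa [(Fin.succ_ne_zero j).symm] using hwb j
      · simpa using hbw i
      · simpa using hb i j
  obtain ⟨b, hb⟩ := hstep _ le_rfl
  refine ⟨Module.Basis.mk (hli b hb)
    ((hli b hb).span_eq_top_of_card_eq_finrank' (by simp)).ge, ?_⟩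
  simpa using hb

theorem sesq_invariant_of_basis {ι : Type*} {τ : K →+* K} {H : V → V →ₗ[K] K}
    (hH : ∀ u v, H v u = τ (H u v)) (b : Module.Basis ι K V) (g : V →ₗ[K] V)
    (hg : ∀ i j, H (g (b i)) (g (b j)) = H (b i) (b j)) (u v : V) : H (g u) (g v) = H u v := by
  have h1 : ∀ i v, H (g (b i)) (g v) = H (b i) v := fun i v =>
    congrArg (fun k : V →ₗ[K] K => k v)
      (b.ext (hg i) : H (g (b i)) ∘ₗ g = H (b i))
  exact congrArg (fun k : V →ₗ[K] K => k v)
    (b.ext fun i => (hH _ _).trans ((congrArg τ (h1 i u)).trans (hH _ _).symm) :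
      H (g u) ∘ₗ g = H u)

end Hermitian

section Unitary

theorem mem_GUGroup_iff {a p e : ℕ} [Fact p.Prime] (A : GL (Fin a) (GaloisField p (2 * e))) :
    A ∈ GUGroup a p e ↔ (A.1)ᵀ * A.1.map (fun x => x ^ p ^ e) = 1 := by
  let M : GL (Fin a) (GaloisField p (2 * e)) :=
    Units.map (RingHom.mapMatrix (frobPow (GaloisField p (2 * e)) p e)).toMonoidHom A
  have hM : M.1 = A.1.map (fun x => x ^ p ^ e) := rfl
  have h1 : A ∈ GUGroup a p e ↔ ((M⁻¹ : GL _ _) : Matrix _ _ _)ᵀ = A.1 :=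
    ⟨fun h => congrArg Units.val h, fun h => Units.ext h⟩
  rw [h1, ← hM]
  constructor
  · intro h
    rw [← h, Matrix.transpose_transpose, Units.inv_mul]
  · intro h
    rw [← Matrix.transpose_transpose A.1]
    congr 1
    calc (M⁻¹).1 = (A.1)ᵀ * M.1 * (M⁻¹).1 := by rw [h, one_mul]
      _ = _ := by rw [mul_assoc, Units.mul_inv, mul_one]

variable {F K V : Type*} [Field F] [Field K] [Algebra F K] [AddCommGroup V]
  [Module F V] [Module K V] [IsScalarTower F K V]

/-- A bilinear form over `F` compatible with an involution of `K` is the trace of a Hermitian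
form over `K`. -/
theorem exists_trace_hermitian [FiniteDimensional F K] [Algebra.IsSeparable F K]
    (B : LinearMap.BilinForm F V) (hsymm : ∀ u v, B u v = B v u) (τ : K ≃ₐ[F] K)
    (hτ : ∀ x, τ (τ x) = x) (hBτ : ∀ (x : K) (u v : V), B (x • u) v = B u (τ x • v)) :
    ∃ H : V → V →ₗ[K] K, (∀ x u v, Algebra.trace F K (x * H v u) = B (x • u) v) ∧
      ∀ u v, H v u = τ (H u v) := by
  have hnd := traceForm_nondegenerate F K
  have hext : ∀ y z : K, (∀ x, Algebra.trace F K (x * y) = Algebra.trace F K (x * z)) →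
      y = z := fun y z h => by
    rw [← sub_eq_zero]
    refine hnd.1 _ fun x => ?_
    rw [Algebra.traceForm_apply, mul_comm, mul_sub, map_sub, h, sub_self]
  have hex : ∀ v u : V, ∃ y : K, ∀ x, Algebra.trace F K (x * y) = B (x • u) v := by
    intro v u
    let l : Module.Dual F K :=
      { toFun x := B (x • u) v
        map_add' x y := by rw [add_smul, map_add, LinearMap.add_apply]
        map_smul' r x := by rw [smul_assoc, map_smul, LinearMap.smul_apply, RingHom.id_apply] }
    obtain ⟨y, hy⟩ := (LinearMap.BilinForm.toDual _ hnd).surjective l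
    refine ⟨y, fun x => ?_⟩
    have h := congrArg (fun k : Module.Dual F K => k x) hy
    simp only [LinearMap.BilinForm.toDual_def, Algebra.traceForm_apply] at h
    rw [mul_comm]
    exact h
  choose h hh using hex
  refine ⟨fun v => { toFun := h v, map_add' := fun u u' => ?_, map_smul' := fun x u => ?_ },
    fun x u v => hh v u x, fun u v => ?_⟩
  · refine hext _ _ fun x => ?_
    rw [hh, mul_add, map_add, hh, hh, smul_add, map_add, LinearMap.add_apply]
  · refine hext _ _ fun y => ?_
    rw [hh, RingHom.id_apply, smul_eq_mul, ← mul_assoc, hh, mul_smul]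
  · refine hext _ _ fun x => ?_
    change Algebra.trace F K (x * h v u) = Algebra.trace F K (x * τ (h u v))
    have h1 : x * τ (h u v) = τ (τ x * h u v) := by rw [map_mul, hτ]
    rw [h1, Algebra.trace_eq_of_algEquiv, hh, hh, hBτ x u v, hsymm]

/-- The centralizer of a semisimple isometry with irreducible self-dual minimal polynomial is a
unitary group. -/
theorem exists_bilinCentralizer_mulEquiv_GUGroup [Fintype F] [Finite K] [CharP F 2]
    [FiniteDimensional F V] [Nontrivial V] {f : ℕ} (hf : 0 < f) (hF : Fintype.card F = 2 ^ f)
    (B : LinearMap.BilinForm F V) (hsymm : ∀ u v, B u v = B v u)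
    (hB : ∀ v, (∀ w, B v w = 0) → v = 0) {x₀ : K} (hx₀ : Algebra.adjoin F {x₀} = ⊤)
    {s : Module.End F V} (hs : ∀ v, s v = x₀ • v) (τ : K ≃ₐ[F] K)
    (hτ : ∀ x, τ (τ x) = x) (hτ1 : ∃ x, τ x ≠ x)
    (hBτ : ∀ (x : K) (u v : V), B (x • u) v = B u (τ x • v)) :
    ∃ a k, 0 < a ∧ 0 < k ∧ Module.finrank F V = 2 * (k * a) ∧
      Nonempty (bilinCentralizer B s ≃* GUGroup a 2 (f * k)) := by
  have : CharP K 2 := charP_of_injective_algebraMap (algebraMap F K).injective 2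
  have : FiniteDimensional K V := Module.Finite.of_restrictScalars_finite F K V
  have : FiniteDimensional F K := Module.Finite.of_finite
  obtain ⟨k, hk, hFK, hτk⟩ := exists_involution_eq_pow τ hτ hτ1
  obtain ⟨H, hHtr, hH⟩ := exists_trace_hermitian B hsymm τ hτ hBτ
  have hHB : ∀ u v, B u v = Algebra.trace F K (H v u) := fun u v => by
    have := hHtr 1 u v
    rw [one_mul, one_smul] at this
    exact this.symm
  obtain ⟨b, hb⟩ := exists_orthonormal_basis (τ : K →+* K) hτ1 H hH fun v hv => hB v fun w => by
    rw [hsymm, hHB, hv, map_zero]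
  have hH' : ∀ u v, H v u = (τ : K →+* K) (H u v) := hH
  have hcard : Nat.card K = 2 ^ (2 * (f * k)) := by
    rw [Module.natCard_eq_pow_finrank (K := F), Nat.card_eq_fintype_card, hF, hFK, ← pow_mul]
    congr 1
    ring
  have hfk : 0 < f * k := Nat.mul_pos hf hk
  obtain ⟨σ⟩ := nonempty_galoisField_ringEquiv (p := 2) (by omega : 2 * (f * k) ≠ 0) hcard
  refine ⟨Module.finrank K V, k, Module.finrank_pos, hk, ?_, ?_⟩
  · rw [← Module.finrank_mul_finrank F K V, hFK, mul_assoc]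
  refine nonempty_mulEquiv_of_range ((glToEnd (F := F) b σ).comp (GUGroup _ 2 (f * k)).subtype)
    ((glToEnd_injective b σ).comp Subtype.val_injective) _ fun g => ?_
  have hgram : ∀ A : GL (Fin (Module.finrank K V)) (GaloisField 2 (2 * (f * k))), ∀ j l,
      H (glToEnd (F := F) b σ A (b l)) (glToEnd (F := F) b σ A (b j)) =
        σ (((A.1)ᵀ * A.1.map (fun x => x ^ 2 ^ (f * k))) j l) := by
    intro A j l
    rw [glToEnd_basis, glToEnd_basis, sesq_sum_smul hH', Matrix.mul_apply, map_sum]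
    refine Finset.sum_congr rfl fun i _ => ?_
    rw [map_sum]
    simp only [map_smul, hb, smul_eq_mul, mul_ite, mul_one, mul_zero, Finset.sum_ite_eq,
      Finset.mem_univ, if_true, Matrix.transpose_apply, Matrix.map_apply, map_mul, map_pow]
    rw [mul_comm]
    congr 1
    change τ (σ (A.1 i l)) = _
    rw [hτk, hF, ← pow_mul]
  have hunit : ∀ A : GL (Fin (Module.finrank K V)) (GaloisField 2 (2 * (f * k))),
      A ∈ GUGroup _ 2 (f * k) ↔ ∀ u v, H (glToEnd (F := F) b σ A v) (glToEnd (F := F) b σ A u) =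
        H v u := by
    intro A
    have hone : ∀ j l, H (b l) (b j) =
        σ ((1 : Matrix (Fin (Module.finrank K V)) (Fin (Module.finrank K V)) _) j l) := by
      intro j l
      rw [hb, Matrix.one_apply, apply_ite σ, map_one, map_zero]
      simp only [eq_comm]
    rw [mem_GUGroup_iff]
    constructor
    · intro hA u v
      exact sesq_invariant_of_basis hH' b (Matrix.toLin b b (A.1.map σ))
        (fun l j => (hgram A j l).trans (by rw [hA, hone])) v u
    · intro hA
      ext j l
      apply σ.injective
      rw [← hgram, hA, hone]
  rw [mem_bilinCentralizer, commutes_iff_smul_of_adjoin_eq_top hx₀ hs]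
  constructor
  · rintro ⟨hg, hgK⟩
    have hinj : Function.Injective g := injective_of_mem_bilinCentralizer hB
      (mem_bilinCentralizer.2 ⟨hg, (commutes_iff_smul_of_adjoin_eq_top hx₀ hs g).2 hgK⟩)
    obtain ⟨A, rfl⟩ := (exists_glToEnd_eq_iff b σ g).2 ⟨hinj, hgK⟩
    refine ⟨⟨A, (hunit A).2 fun u v => ?_⟩, rfl⟩
    rw [← sub_eq_zero]
    refine (traceForm_nondegenerate F K).1 _ fun x => ?_
    rw [Algebra.traceForm_apply, mul_comm, mul_sub, map_sub, hHtr, hHtr, ← hgK, hg, sub_self]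
  · rintro ⟨A, rfl⟩
    refine ⟨fun u v => ?_, glToEnd_smul b σ A.1⟩
    rw [hHB, hHB]
    exact congrArg _ ((hunit A.1).1 A.2 u v)

end Unitary

section FieldAction

open Polynomial

/-- An endomorphism annihilated by an irreducible polynomial `p` makes the space a vector space
over the field `F[X] / (p)`. -/
theorem exists_field_action {F V : Type} [Field F] [Finite F] [AddCommGroup V] [Module F V]
    [FiniteDimensional F V] [Nontrivial V] (s : Module.End F V) {p : F[X]} (hp : Irreducible p)
    (hs : aeval s p = 0) :
    ∃ (K : Type) (_ : Field K) (_ : Algebra F K) (_ : Finite K) (_ : Module K V)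
      (_ : IsScalarTower F K V) (x₀ : K), Algebra.adjoin F {x₀} = ⊤ ∧ (∀ v, s v = x₀ • v) ∧
      ∀ y : K, aeval y p = 0 → ∃ τ : K →ₐ[F] K, τ x₀ = y := by
  let I : Ideal F[X] := Ideal.span {p}
  have hI : I.IsMaximal := PrincipalIdealRing.isMaximal_of_irreducible hp
  let K := F[X] ⧸ I
  let : Field K := Ideal.Quotient.field I
  have hker : ∀ {A : Type} [Ring A] [Algebra F A] (y : A), aeval y p = 0 →
      ∀ q ∈ I, aeval y q = 0 := fun y hy q hq => by
    obtain ⟨r, rfl⟩ := Ideal.mem_span_singleton.1 hq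
    rw [map_mul, hy, zero_mul]
  let φ : K →ₐ[F] Module.End F V := Ideal.Quotient.liftₐ I (aeval s) (hker s hs)
  have hfin : Finite K := by
    have : Finite V := Module.finite_of_finite F
    have : Finite (Module.End F V) := Finite.of_injective _ DFunLike.coe_injective
    exact Finite.of_injective φ φ.toRingHom.injective
  let : Module K V := Module.compHom V φ.toRingHom
  have hsmul : ∀ (x : K) (v : V), x • v = φ x v := fun x v => rfl
  refine ⟨K, inferInstance, inferInstance, hfin, inferInstance, ⟨fun r x v => ?_⟩,
    Ideal.Quotient.mk I X, ?_, fun v => ?_, fun y hy => ?_⟩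
  · rw [hsmul, map_smul]; rfl
  · refine Algebra.eq_top_iff.2 fun x => ?_
    obtain ⟨q, rfl⟩ := Ideal.Quotient.mk_surjective x
    have h : aeval (Ideal.Quotient.mk I X) q = Ideal.Quotient.mk I q := by
      have := aeval_algHom_apply (Ideal.Quotient.mkₐ F I) X q
      rw [aeval_X_left_apply] at this
      exact this
    rw [← h]
    exact aeval_mem_adjoin_singleton F _
  · rw [hsmul]
    have h : φ (Ideal.Quotient.mk I X) = aeval s X := rfl
    rw [h, aeval_X]
  · exact ⟨Ideal.Quotient.liftₐ I (aeval y) (hker y hy), aeval_X y⟩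

/-- The centralizer in `GL(V)` of an endomorphism with irreducible minimal polynomial. -/
theorem exists_injCentralizer_mulEquiv_GL {F V : Type} [Field F] [Fintype F] [AddCommGroup V]
    [Module F V] [FiniteDimensional F V] [Nontrivial V] {f : ℕ} (hf : 0 < f)
    (hF : Fintype.card F = 2 ^ f) (s : Module.End F V) {p : F[X]} (hp : Irreducible p)
    (hs : aeval s p = 0) :
    ∃ a k, 0 < a ∧ 0 < k ∧ Module.finrank F V = k * a ∧
      Nonempty (injCentralizer s ≃* GL (Fin a) (GaloisField 2 (f * k))) := by
  obtain ⟨K, _, _, _, _, _, x₀, hx₀, hsx, -⟩ := exists_field_action s hp hs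
  have : FiniteDimensional K V := Module.Finite.of_restrictScalars_finite F K V
  have : FiniteDimensional F K := Module.Finite.of_finite
  have hk : 0 < Module.finrank F K := Module.finrank_pos
  have hcard : Nat.card K = 2 ^ (f * Module.finrank F K) := by
    rw [Module.natCard_eq_pow_finrank (K := F), Nat.card_eq_fintype_card, hF, ← pow_mul]
  obtain ⟨σ⟩ := nonempty_galoisField_ringEquiv (p := 2) (Nat.mul_pos hf hk).ne' hcard
  refine ⟨Module.finrank K V, Module.finrank F K, Module.finrank_pos, hk,
    (Module.finrank_mul_finrank F K V).symm, ?_⟩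
  refine nonempty_mulEquiv_of_range (glToEnd (F := F) (Module.finBasis K V) σ)
    (glToEnd_injective _ σ) _ fun g => ?_
  rw [exists_glToEnd_eq_iff, mem_injCentralizer, commutes_iff_smul_of_adjoin_eq_top hx₀ hsx]

end FieldAction

section DualPair

variable {F V : Type*} [Field F] [AddCommGroup V] [Module F V] [FiniteDimensional F V]

theorem exists_dual_equiv_of_isotropic (B : LinearMap.BilinForm F V)
    (hsymm : ∀ u v, B u v = B v u) (hB : ∀ v, (∀ w, B v w = 0) → v = 0) {U U' : Submodule F V}
    (hU : IsCompl U U') (hBU : ∀ u ∈ U, ∀ v ∈ U, B u v = 0)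
    (hBU' : ∀ u ∈ U', ∀ v ∈ U', B u v = 0) :
    ∃ e : U' ≃ₗ[F] Module.Dual F U, ∀ (u' : U') (u : U), e u' u = B u u' := by
  have key : ∀ {U U' : Submodule F V}, IsCompl U U' → (∀ u ∈ U', ∀ v ∈ U', B u v = 0) →
      Function.Injective (B.flip.domRestrict₁₂ U' U) := by
    intro U U' hU hBU'
    refine (injective_iff_map_eq_zero _).2 fun x hx => Subtype.ext (hB x fun w => ?_)
    obtain ⟨u, hu, u', hu', rfl⟩ := Submodule.mem_sup.1
      (show w ∈ U ⊔ U' by rw [hU.sup_eq_top]; trivial)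
    have h1 : B u x = 0 := congrArg (fun k : Module.Dual F U => k ⟨u, hu⟩) hx
    rw [map_add, hsymm x u, h1, hBU' x x.2 u' hu', add_zero]
  have h1 := LinearMap.finrank_le_finrank_of_injective (key hU hBU')
  have h2 := LinearMap.finrank_le_finrank_of_injective (key hU.symm hBU)
  have h3 : ∀ W : Submodule F V, Module.finrank F (W →ₗ[F] F) = Module.finrank F W := fun W =>
    Subspace.dual_finrank_eq
  rw [h3] at h1 h2
  exact ⟨LinearEquiv.ofInjectiveOfFinrankEq (B.flip.domRestrict₁₂ U' U) (key hU hBU')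
    ((le_antisymm h1 h2).trans (h3 U).symm), fun u' u => rfl⟩

/-- The isometries commuting with `s` and stabilizing the two totally isotropic summands `U`, `U'`
are determined by their action on `U`, which is arbitrary. -/
theorem nonempty_bilinCentralizer_mulEquiv_injCentralizer (B : LinearMap.BilinForm F V)
    (hsymm : ∀ u v, B u v = B v u) (hB : ∀ v, (∀ w, B v w = 0) → v = 0) {s : Module.End F V}
    (hs : ∀ u v, B (s u) (s v) = B u v) {U U' : Submodule F V} (hU : IsCompl U U')
    (hBU : ∀ u ∈ U, ∀ v ∈ U, B u v = 0) (hBU' : ∀ u ∈ U', ∀ v ∈ U', B u v = 0)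
    (hcU : ∀ g : Module.End F V, (∀ v, g (s v) = s (g v)) → ∀ u ∈ U, g u ∈ U)
    (hcU' : ∀ g : Module.End F V, (∀ v, g (s v) = s (g v)) → ∀ u ∈ U', g u ∈ U') :
    Nonempty (bilinCentralizer B s ≃*
      injCentralizer (s.restrict (hcU s fun _ => rfl) : Module.End F U)) := by
  have hinj : ∀ {g : Module.End F V}, g ∈ bilinCentralizer B s → Function.Injective g :=
    fun hg => injective_of_mem_bilinCentralizer hB hg
  have hsinj : Function.Injective s := hinj ⟨hs, fun _ => rfl⟩
  have hdec : ∀ v : V, ∃ (u : U) (u' : U'), v = u + u' := fun v => by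
    obtain ⟨u, hu, u', hu', rfl⟩ := Submodule.mem_sup.1
      (show v ∈ U ⊔ U' by rw [hU.sup_eq_top]; trivial)
    exact ⟨⟨u, hu⟩, ⟨u', hu'⟩, rfl⟩
  have hzero : ∀ x ∈ U', (∀ u ∈ U, B u x = 0) → x = 0 := fun x hx h => hB x fun w => by
    obtain ⟨u, u', rfl⟩ := hdec w
    rw [map_add, hsymm x u, h u u.2, hBU' x hx u' u'.2, add_zero]
  have hsurj : ∀ g : Module.End F U, Function.Injective g → ∀ u ∈ U, ∃ w : U, (g w : V) = u :=
    fun g hg u hu => by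
      obtain ⟨w, hw⟩ := LinearMap.injective_iff_surjective.1 hg ⟨u, hu⟩
      exact ⟨w, congrArg Subtype.val hw⟩
  have hresinj : ∀ (g : Module.End F V) (h : ∀ u ∈ U, g u ∈ U), Function.Injective g →
      Function.Injective (g.restrict h) := fun g h hg x y hxy =>
    Subtype.ext (hg (congrArg Subtype.val hxy))
  let φ : bilinCentralizer B s →* injCentralizer (s.restrict (hcU s fun _ => rfl)) :=
    { toFun g := ⟨g.1.restrict (hcU g g.2.2), hresinj _ _ (hinj g.2),
        fun v => Subtype.ext (g.2.2 v)⟩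
      map_one' := rfl
      map_mul' _ _ := rfl }
  refine ⟨MulEquiv.ofBijective φ ⟨fun g h hgh => ?_, fun g₀ => ?_⟩⟩
  · have e₁ : ∀ u ∈ U, g.1 u = h.1 u := fun u hu =>
      congrArg (fun k : injCentralizer (s.restrict (hcU s fun _ => rfl)) =>
        ((k.1 ⟨u, hu⟩ : U) : V)) hgh
    apply Subtype.ext
    ext v
    obtain ⟨u, u', rfl⟩ := hdec v
    rw [map_add, map_add, e₁ u u.2, add_right_inj, ← sub_eq_zero]
    refine hzero _ (Submodule.sub_mem _ (hcU' _ g.2.2 _ u'.2) (hcU' _ h.2.2 _ u'.2))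
      fun w hw => ?_
    obtain ⟨w, rfl⟩ := hsurj _ (hresinj _ (hcU g g.2.2) (hinj g.2)) w hw
    change B (g.1 w) _ = 0
    rw [map_sub, g.2.1, e₁ w w.2, h.2.1, sub_self]
  · obtain ⟨e, he⟩ := exists_dual_equiv_of_isotropic B hsymm hB hU hBU hBU'
    let gE : U ≃ₗ[F] U := LinearEquiv.ofInjectiveEndo g₀.1 g₀.2.1
    have hgE : ∀ u, gE u = g₀.1 u := fun u => rfl
    let g' : U' →ₗ[F] U' := e.symm.toLinearMap ∘ₗ gE.symm.toLinearMap.dualMap ∘ₗ e.toLinearMap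
    have hg' : ∀ (u : U) (u' : U'), B (g₀.1 u) (g' u') = B u u' := fun u u' => by
      have h1 : e (g' u') = (e u').comp gE.symm.toLinearMap := e.apply_symm_apply _
      rw [← he, h1, ← he, ← hgE]
      simp
    let g : Module.End F V := LinearMap.ofIsCompl hU (U.subtype ∘ₗ g₀.1) (U'.subtype ∘ₗ g')
    have a₁ : ∀ x : U, g x = g₀.1 x := fun x => LinearMap.ofIsCompl_apply_left hU x
    have a₂ : ∀ x : U', g x = g' x := fun x => LinearMap.ofIsCompl_apply_right hU x
    have hsg : ∀ u : U, ((g₀.1 ⟨s u, hcU s (fun _ => rfl) u u.2⟩ : U) : V) = s (g₀.1 u) :=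
      fun u => congrArg Subtype.val (g₀.2.2 u)
    refine ⟨⟨g, fun v w => ?_, fun v => ?_⟩, Subtype.ext (LinearMap.ext fun x =>
      Subtype.ext (a₁ x))⟩
    · obtain ⟨u, u', rfl⟩ := hdec v
      obtain ⟨w, w', rfl⟩ := hdec w
      simp only [map_add, LinearMap.add_apply, a₁, a₂]
      rw [hBU _ (g₀.1 u).2 _ (g₀.1 w).2, hBU' _ (g' u').2 _ (g' w').2, hg',
        hsymm (g' u') (g₀.1 w), hg', hBU u u.2 w w.2, hBU' u' u'.2 w' w'.2, hsymm u' w]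
    · obtain ⟨u, u', rfl⟩ := hdec v
      have b₁ : g (s u) = s (g u) := by
        rw [a₁ u, ← hsg u, ← a₁]
      have b₂ : g (s u') = s (g u') := by
        have hsu' : s u' ∈ U' := hcU' s (fun _ => rfl) u' u'.2
        rw [a₂ u', show g (s u') = g' ⟨s u', hsu'⟩ from a₂ ⟨s u', hsu'⟩, ← sub_eq_zero]
        refine hzero _ (Submodule.sub_mem _ (g' _).2 (hcU' s (fun _ => rfl) _ (g' _).2))
          fun x hx => ?_
        obtain ⟨y, rfl⟩ := hsurj _ g₀.2.1 x hx
        obtain ⟨w, hw⟩ := hsurj _ (hresinj _ (hcU s fun _ => rfl) hsinj) y y.2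
        replace hw : s w = y := hw
        have c₁ : B (g₀.1 y) (g' ⟨s u', hsu'⟩) = B w u' := by
          rw [hg', ← hw, hs]
        have c₂ : B (g₀.1 y) (s (g' u')) = B w u' := by
          have : y = ⟨s w, hcU s (fun _ => rfl) w w.2⟩ := Subtype.ext hw.symm
          rw [this, hsg, hs, hg']
        rw [map_sub, c₁, c₂, sub_self]
      simp only [map_add, b₁, b₂]

end DualPair

section Blocks

open Polynomial

variable {F V : Type} [Field F] [AddCommGroup V] [Module F V]

theorem aeval_apply_of_smul {K : Type} [Field K] [Algebra F K] [Module K V] [IsScalarTower F K V]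
    {s : Module.End F V} {x : K} (hs : ∀ v, s v = x • v) (p : F[X]) (v : V) :
    aeval s p v = aeval x p • v := by
  induction p using Polynomial.induction_on' generalizing v with
  | add p q hp hq => simp [hp, hq, add_smul]
  | monomial n a =>
    rw [aeval_monomial, aeval_monomial]
    simp only [Module.End.mul_apply, Module.algebraMap_end_apply, mul_smul, algebraMap_smul]
    congr 1
    induction n generalizing v with
    | zero => simp
    | succ n ih => rw [pow_succ, pow_succ, Module.End.mul_apply, hs, ih, mul_smul]

theorem bilin_inverse {B : LinearMap.BilinForm F V} {s s' : Module.End F V}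
    (hs : ∀ u v, B (s u) (s v) = B u v) (hss' : s * s' = 1) (u v : V) :
    B (s' u) (s' v) = B u v := by
  rw [← hs, ← Module.End.mul_apply, ← Module.End.mul_apply, hss', Module.End.one_apply,
    Module.End.one_apply]

theorem commute_inverse_apply {s s' g : Module.End F V} (hss' : s * s' = 1) (hs's : s' * s = 1)
    (hg : ∀ v, g (s v) = s (g v)) (v : V) : g (s' v) = s' (g v) := by
  have h1 := hg (s' v)
  rw [← Module.End.mul_apply s, hss', Module.End.one_apply] at h1
  rw [h1, ← Module.End.mul_apply s', hs's, Module.End.one_apply]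

/-- A space on which an isometry and its inverse have the same irreducible minimal polynomial
carries a hermitian structure, whose unitary group is the centralizer. -/
theorem exists_mulEquiv_GUGroup_of_aeval_eq_zero [Fintype F] [CharP F 2] [FiniteDimensional F V]
    [Nontrivial V] {f : ℕ} (hf : 0 < f) (hF : Fintype.card F = 2 ^ f)
    (B : LinearMap.BilinForm F V) (hsymm : ∀ u v, B u v = B v u)
    (hB : ∀ v, (∀ w, B v w = 0) → v = 0) {s s' : Module.End F V}
    (hs : ∀ u v, B (s u) (s v) = B u v) (hss' : s * s' = 1) {p : F[X]} (hp : Irreducible p)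
    (hps : aeval s p = 0) (hps' : aeval s' p = 0) (hfix : ∀ v, s v = v → v = 0) :
    ∃ a k, 0 < a ∧ 0 < k ∧ Module.finrank F V = 2 * (k * a) ∧
      Nonempty (bilinCentralizer B s ≃* GUGroup a 2 (f * k)) := by
  obtain ⟨K, _, _, _, _, _, x₀, hx₀, hsx, hτ⟩ := exists_field_action s hp hps
  obtain ⟨v₀, hv₀⟩ := exists_ne (0 : V)
  have hinv : ∀ v, x₀ • s' v = v := fun v => by
    rw [← hsx, ← Module.End.mul_apply, hss', Module.End.one_apply]
  have hx0 : x₀ ≠ 0 := by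
    rintro rfl
    exact hv₀ (by rw [← hinv v₀, zero_smul])
  have hsx' : ∀ v, s' v = x₀⁻¹ • v := fun v => by
    conv_rhs => rw [← hinv v, smul_smul, inv_mul_cancel₀ hx0, one_smul]
  have hroot : aeval x₀⁻¹ p = 0 := by
    have h1 := aeval_apply_of_smul hsx' p v₀
    rw [hps', LinearMap.zero_apply] at h1
    exact (smul_eq_zero.1 h1.symm).resolve_right hv₀
  obtain ⟨τ, hτx⟩ := hτ _ hroot
  have hττ : τ.comp τ = AlgHom.id F K := by
    refine AlgHom.ext_of_adjoin_eq_top hx₀ fun x hx => ?_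
    rw [Set.mem_singleton_iff] at hx
    subst hx
    simp [hτx]
  refine exists_bilinCentralizer_mulEquiv_GUGroup hf hF B hsymm hB hx₀ hsx
    (AlgEquiv.ofAlgHom τ τ hττ hττ) (fun x => DFunLike.congr_fun hττ x) ⟨x₀, fun h => ?_⟩
    fun x => ?_
  · have : CharP K 2 := charP_of_injective_algebraMap (algebraMap F K).injective 2
    change τ x₀ = x₀ at h
    rw [hτx, inv_eq_iff_eq_inv, ← mul_eq_one_iff_eq_inv₀ hx0, ← pow_two] at h
    have h1 : (x₀ - 1) ^ 2 = 0 := by rw [sub_pow_char, h]; simp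
    rw [sq_eq_zero_iff, sub_eq_zero] at h1
    exact hv₀ (hfix v₀ (by rw [hsx, h1, one_smul]))
  · change ∀ u v, B (x • u) v = B u (τ x • v)
    have hx : x ∈ Algebra.adjoin F {x₀} := by rw [hx₀]; trivial
    induction hx using Algebra.adjoin_induction with
    | mem y hy =>
      intro u v
      rw [Set.mem_singleton_iff] at hy
      subst hy
      rw [hτx, ← hsx', ← hsx, ← hs u, ← Module.End.mul_apply s s', hss', Module.End.one_apply]
    | algebraMap r => intro u v; simp
    | add y z _ _ hy hz => intro u v; simp [add_smul, hy, hz]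
    | mul y z _ _ hy hz =>
      intro u v
      rw [mul_smul, hy, hz, map_mul, mul_comm, mul_smul]

theorem isotropic_ker_aeval [FiniteDimensional F V] {B : LinearMap.BilinForm F V}
    {s s' : Module.End F V} (hs : ∀ u v, B (s u) (s v) = B u v) (hss' : s * s' = 1)
    (hs's : s' * s = 1) {p : F[X]}
    (hd : Disjoint (LinearMap.ker (aeval s p)) (LinearMap.ker (aeval s' p))) :
    ∀ u ∈ LinearMap.ker (aeval s p), ∀ v ∈ LinearMap.ker (aeval s p), B u v = 0 := by
  have hcomm : ∀ v, aeval s' p (aeval s p v) = aeval s p (aeval s' p v) :=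
    commute_aeval_apply (fun v => (commute_aeval_apply (fun v => by
      rw [← Module.End.mul_apply, ← Module.End.mul_apply, hss', hs's]) p v).symm) p
  have hT : ∀ v ∈ LinearMap.ker (aeval s p), aeval s' p v ∈ LinearMap.ker (aeval s p) :=
    fun v hv => by rw [LinearMap.mem_ker] at *; rw [← hcomm, hv, map_zero]
  have hinj : Function.Injective ((aeval s' p).restrict hT) :=
    (injective_iff_map_eq_zero _).2 fun x hx => Subtype.ext
      (Submodule.disjoint_def.1 hd x x.2 (congrArg Subtype.val hx))
  intro u hu v hv
  obtain ⟨w, hw⟩ := LinearMap.injective_iff_surjective.1 hinj ⟨v, hv⟩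
  have hw' : aeval s' p w = v := congrArg Subtype.val hw
  rw [← hw', ← bilin_aeval_left hs hss', LinearMap.mem_ker.1 hu, map_zero, LinearMap.zero_apply]

/-- If the kernels of `p` in an isometry and in its inverse are complementary, they form a dual
pair of totally isotropic subspaces and the centralizer is a linear group. -/
theorem exists_mulEquiv_GL_of_isCompl [Fintype F] [FiniteDimensional F V]
    [Nontrivial V] {f : ℕ} (hf : 0 < f) (hF : Fintype.card F = 2 ^ f)
    (B : LinearMap.BilinForm F V) (hsymm : ∀ u v, B u v = B v u)
    (hB : ∀ v, (∀ w, B v w = 0) → v = 0) {s s' : Module.End F V}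
    (hs : ∀ u v, B (s u) (s v) = B u v) (hss' : s * s' = 1) (hs's : s' * s = 1)
    {p : F[X]} (hp : Irreducible p)
    (hc : IsCompl (LinearMap.ker (aeval s p)) (LinearMap.ker (aeval s' p))) :
    ∃ a k, 0 < a ∧ 0 < k ∧ Module.finrank F V = 2 * (k * a) ∧
      Nonempty (bilinCentralizer B s ≃* GL (Fin a) (GaloisField 2 (f * k))) := by
  have hBU := isotropic_ker_aeval hs hss' hs's hc.disjoint
  have hBU' := isotropic_ker_aeval (bilin_inverse hs hss') hs's hss' hc.disjoint.symm
  have hcU : ∀ g : Module.End F V, (∀ v, g (s v) = s (g v)) →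
      ∀ u ∈ LinearMap.ker (aeval s p), g u ∈ LinearMap.ker (aeval s p) := fun g hg u hu => by
    rw [LinearMap.mem_ker] at *
    rw [← commute_aeval_apply hg, hu, map_zero]
  have hcU' : ∀ g : Module.End F V, (∀ v, g (s v) = s (g v)) →
      ∀ u ∈ LinearMap.ker (aeval s' p), g u ∈ LinearMap.ker (aeval s' p) := fun g hg u hu => by
    rw [LinearMap.mem_ker] at *
    rw [← commute_aeval_apply (commute_inverse_apply hss' hs's hg), hu, map_zero]
  obtain ⟨e, -⟩ := exists_dual_equiv_of_isotropic B hsymm hB hc hBU hBU'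
  have hdim : Module.finrank F V = 2 * Module.finrank F (LinearMap.ker (aeval s p)) := by
    rw [← Submodule.finrank_add_eq_of_isCompl hc, e.finrank_eq, Subspace.dual_finrank_eq, two_mul]
  have : Nontrivial (LinearMap.ker (aeval s p)) := by
    have := Module.finrank_pos (R := F) (M := V)
    exact Module.nontrivial_of_finrank_pos (R := F) (by omega)
  obtain ⟨a, k, ha, hk, hak, ⟨φ⟩⟩ := exists_injCentralizer_mulEquiv_GL hf hF
    (s.restrict (hcU s fun _ => rfl)) hp (LinearMap.ext fun x => Subtype.ext
      ((restrict_aeval_apply (hcU s fun _ => rfl) p x).trans x.2))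
  obtain ⟨ψ⟩ := nonempty_bilinCentralizer_mulEquiv_injCentralizer B hsymm hB hs hc hBU hBU'
    hcU hcU'
  exact ⟨a, k, ha, hk, by rw [hdim, hak], ⟨ψ.trans φ⟩⟩

theorem aeval_comp_pow (s : Module.End F V) (p : F[X]) (M : ℕ) :
    aeval s (p.comp (X ^ M)) = aeval (s ^ M) p := by
  rw [aeval_comp, map_pow, aeval_X]

theorem pow_pow_eq_self {M : Type*} [Monoid M] {s : M} {N : ℕ} (hs : s ^ (N + 1) = 1) :
    (s ^ N) ^ N = s := by
  have h : (s ^ N) ^ N * (s ^ N * s) = s := by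
    rw [← mul_assoc, ← pow_succ, ← pow_mul, mul_comm N, pow_mul, hs, one_pow, one_mul]
  rwa [← pow_succ, hs, mul_one] at h

/-- The centralizer of an isometry without fixed points of order prime to the characteristic,
on a space annihilated by `p(s) p(s⁻¹)` with `p` irreducible. -/
theorem exists_mulEquiv_GLsign [Fintype F] [CharP F 2] [FiniteDimensional F V]
    [Nontrivial V] {f : ℕ} (hf : 0 < f) (hF : Fintype.card F = 2 ^ f)
    (B : LinearMap.BilinForm F V) (hsymm : ∀ u v, B u v = B v u)
    (hB : ∀ v, (∀ w, B v w = 0) → v = 0) {s : Module.End F V}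
    (hs : ∀ u v, B (s u) (s v) = B u v) {N : ℕ} (hsN : s ^ (N + 1) = 1)
    (hN : (Fintype.card F).Coprime (N + 1)) {p : F[X]} (hp : Irreducible p)
    (hps : ∀ v, aeval s p (aeval (s ^ N) p v) = 0) (hfix : ∀ v, s v = v → v = 0) :
    ∃ (α : Bool) (a k : ℕ), 0 < a ∧ 0 < k ∧ Module.finrank F V = 2 * (k * a) ∧
      Nonempty (bilinCentralizer B s ≃* GLsign 2 α a (f * k)) := by
  have hss' : s * s ^ N = 1 := by rw [← pow_succ', hsN]
  have hs's : s ^ N * s = 1 := by rw [← pow_succ, hsN]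
  have hs'N : (s ^ N) ^ (N + 1) = 1 := by rw [← pow_mul, mul_comm, pow_mul, hsN, one_pow]
  have hcomm : ∀ v, aeval (s ^ N) p (aeval s p v) = aeval s p (aeval (s ^ N) p v) := fun v => by
    rw [← aeval_comp_pow, ← Module.End.mul_apply, ← Module.End.mul_apply, ← map_mul, ← map_mul,
      mul_comm]
  by_cases hdvd : p ∣ p.comp (X ^ N)
  · obtain ⟨h, hh⟩ := hdvd
    have h1 : ∀ t : Module.End F V, aeval (t ^ N) p = aeval t h * aeval t p := fun t => by
      rw [← aeval_comp_pow, hh, mul_comm, map_mul]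
    have hps' : aeval (s ^ N) p = 0 := LinearMap.ext fun v => by
      refine aeval_eq_zero_of_aeval_aeval_eq_zero hs'N hN p v
        ((DFunLike.congr_fun (h1 s) _).trans ?_)
      rw [Module.End.mul_apply, hps, map_zero]
    have hps0 : aeval s p = 0 := by
      have := h1 (s ^ N)
      rwa [pow_pow_eq_self hsN, hps', mul_zero] at this
    obtain ⟨a, k, ha, hk, hak, hφ⟩ := exists_mulEquiv_GUGroup_of_aeval_eq_zero hf hF B hsymm hB hs
      hss' hp hps0 hps' hfix
    exact ⟨false, a, k, ha, hk, hak, hφ⟩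
  · have hd : Disjoint (LinearMap.ker (aeval s p)) (LinearMap.ker (aeval (s ^ N) p)) := by
      rw [← aeval_comp_pow]
      exact disjoint_ker_aeval_of_isCoprime s ((hp.coprime_iff_not_dvd).2 hdvd)
    have hc : IsCompl (LinearMap.ker (aeval s p)) (LinearMap.ker (aeval (s ^ N) p)) := by
      refine ⟨hd, (isCompl_ker_range_aeval hsN hN p).codisjoint.mono_right ?_⟩
      rintro _ ⟨v, rfl⟩
      rw [LinearMap.mem_ker, hcomm, hps]
    obtain ⟨a, k, ha, hk, hak, hφ⟩ := exists_mulEquiv_GL_of_isCompl hf hF B hsymm hB hs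
      hss' hs's hp hc
    exact ⟨true, a, k, ha, hk, hak, hφ⟩

end Blocks

section FixedPointFree

open Polynomial

variable {F V : Type} [Field F] [AddCommGroup V] [Module F V]

theorem restrict_nondegenerate_of_isCompl {B : LinearMap.BilinForm F V}
    (hB : ∀ v, (∀ w, B v w = 0) → v = 0) {W R : Submodule F V} (hWR : IsCompl W R)
    (hBWR : ∀ u ∈ W, ∀ v ∈ R, B u v = 0) (v : W) (hv : ∀ w, B.domRestrict₁₂ W W v w = 0) :
    v = 0 := by
  refine Subtype.ext (hB v fun x => ?_)
  obtain ⟨w, hw, r, hr, rfl⟩ := Submodule.mem_sup.1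
    (show x ∈ W ⊔ R by rw [hWR.sup_eq_top]; trivial)
  rw [map_add, hBWR v v.2 r hr, add_zero]
  exact hv ⟨w, hw⟩

/-- The centralizer of an isometry preserving an orthogonal decomposition is a product, as soon as
everything commuting with the isometry preserves the decomposition. -/
theorem nonempty_bilinCentralizer_mulEquiv_prod {B : LinearMap.BilinForm F V}
    (hsymm : ∀ u v, B u v = B v u) {s : Module.End F V} {W R : Submodule F V} (hWR : IsCompl W R)
    (hBWR : ∀ u ∈ W, ∀ v ∈ R, B u v = 0)
    (hcW : ∀ g : Module.End F V, (∀ v, g (s v) = s (g v)) → ∀ u ∈ W, g u ∈ W)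
    (hcR : ∀ g : Module.End F V, (∀ v, g (s v) = s (g v)) → ∀ u ∈ R, g u ∈ R) :
    Nonempty (bilinCentralizer B s ≃*
      bilinCentralizer (B.domRestrict₁₂ W W) (s.restrict (hcW s fun _ => rfl) : Module.End F W) ×
      bilinCentralizer (B.domRestrict₁₂ R R)
        (s.restrict (hcR s fun _ => rfl) : Module.End F R)) := by
  refine nonempty_mulEquiv_prod_of_isCompl hWR _ _ _ (fun g hg => hcW g hg.2)
    (fun g hg => hcR g hg.2) fun g hgW hgR => ⟨fun hg => ⟨⟨fun u v => hg.1 u v, fun v =>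
      Subtype.ext (hg.2 v)⟩, ⟨fun u v => hg.1 u v, fun v => Subtype.ext (hg.2 v)⟩⟩, ?_⟩
  rintro ⟨⟨h₁, h₁'⟩, ⟨h₂, h₂'⟩⟩
  have hdec : ∀ v : V, ∃ (u : W) (r : R), v = u + r := fun v => by
    obtain ⟨u, hu, r, hr, rfl⟩ := Submodule.mem_sup.1
      (show v ∈ W ⊔ R by rw [hWR.sup_eq_top]; trivial)
    exact ⟨⟨u, hu⟩, ⟨r, hr⟩, rfl⟩
  refine ⟨fun u v => ?_, fun v => ?_⟩
  · obtain ⟨u, r, rfl⟩ := hdec u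
    obtain ⟨w, t, rfl⟩ := hdec v
    have e₁ : B (g u) (g w) = B u w := h₁ u w
    have e₂ : B (g r) (g t) = B r t := h₂ r t
    simp only [map_add, LinearMap.add_apply, e₁, e₂]
    rw [hBWR _ (hgW u u.2) _ (hgR t t.2), hBWR u u.2 t t.2, hsymm (g r) (g w), hsymm r w,
      hBWR _ (hgW w w.2) _ (hgR r r.2), hBWR w w.2 r r.2]
  · obtain ⟨u, r, rfl⟩ := hdec v
    have e₁ : g (s u) = s (g u) := congrArg Subtype.val (h₁' u)
    have e₂ : g (s r) = s (g r) := congrArg Subtype.val (h₂' r)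
    simp only [map_add, e₁, e₂]

/-- The kernel and the range of a self-adjoint operator are orthogonal. -/
theorem bilin_ker_range_eq_zero {B : LinearMap.BilinForm F V} {T : Module.End F V}
    (hT : ∀ u v, B (T u) v = B u (T v)) :
    ∀ u ∈ LinearMap.ker T, ∀ v ∈ LinearMap.range T, B u v = 0 := by
  rintro u hu _ ⟨v, rfl⟩
  rw [← hT, LinearMap.mem_ker.1 hu, map_zero, LinearMap.zero_apply]

/-- Adjoining a factor in front of a finite product of groups. -/
def finConsMulEquiv {t : ℕ} (G : Fin (t + 1) → Type) [∀ i, Group (G i)] :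
    (G 0 × ((i : Fin t) → G i.succ)) ≃* ((i : Fin (t + 1)) → G i) where
  toFun x := Fin.cons x.1 x.2
  invFun y := (y 0, fun i => y i.succ)
  left_inv _ := rfl
  right_inv y := Fin.cons_self_tail y
  map_mul' x y := by
    ext i
    refine Fin.cases rfl (fun _ => rfl) i

/-- The centralizer of a fixed point free isometry of order prime to the characteristic. -/
theorem exists_mulEquiv_pi_GLsign [Fintype F] [CharP F 2] [FiniteDimensional F V]
    {f : ℕ} (hf : 0 < f) (hF : Fintype.card F = 2 ^ f) (B : LinearMap.BilinForm F V)
    (hsymm : ∀ u v, B u v = B v u) (hB : ∀ v, (∀ w, B v w = 0) → v = 0) {s : Module.End F V}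
    (hs : ∀ u v, B (s u) (s v) = B u v) {N : ℕ} (hsN : s ^ (N + 1) = 1)
    (hN : (Fintype.card F).Coprime (N + 1)) (hfix : ∀ v, s v = v → v = 0) :
    ∃ (t : ℕ) (a κ : Fin t → ℕ) (α : Fin t → Bool), (∀ i, 0 < a i) ∧ (∀ i, 0 < κ i) ∧
      Module.finrank F V = 2 * ∑ i, κ i * a i ∧
      Nonempty (bilinCentralizer B s ≃* ((i : Fin t) → GLsign 2 (α i) (a i) (f * κ i))) := by
  induction hd : Module.finrank F V using Nat.strong_induction_on generalizing V with
  | _ d ih =>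
  subst hd
  rcases subsingleton_or_nontrivial V with hV | hV
  · refine ⟨0, Fin.elim0, Fin.elim0, Fin.elim0, fun i => i.elim0, fun i => i.elim0, ?_, ?_⟩
    · simp [Module.finrank_zero_of_subsingleton]
    · have : Subsingleton (bilinCentralizer B s) :=
        ⟨fun g h => Subtype.ext (LinearMap.ext fun v => Subsingleton.elim _ _)⟩
      have : Unique (bilinCentralizer B s) := uniqueOfSubsingleton 1
      exact ⟨MulEquiv.ofUnique⟩
  have hss' : s * s ^ N = 1 := by rw [← pow_succ', hsN]
  have hs's : s ^ N * s = 1 := by rw [← pow_succ, hsN]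
  have hs'' : (s ^ N) ^ N = s := pow_pow_eq_self hsN
  have hsint : IsIntegral F s := Algebra.IsIntegral.isIntegral s
  obtain ⟨p, hp, r, hr⟩ := exists_irreducible_of_natDegree_pos (minpoly.natDegree_pos hsint)
  have hker : LinearMap.ker (aeval s p) ≠ ⊥ := fun h => by
    have h1 : aeval s r = 0 := LinearMap.ext fun v => by
      refine LinearMap.ker_eq_bot.1 h ?_
      rw [← Module.End.mul_apply, ← map_mul, ← hr, minpoly.aeval]
      simp
    obtain ⟨c, hc⟩ := minpoly.dvd F s h1
    refine hp.not_isUnit (IsUnit.of_mul_eq_one c (mul_left_cancel₀ (minpoly.ne_zero hsint) ?_))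
    rw [mul_one]
    nth_rw 2 [hr]
    rw [hc]
    ring
  let q : F[X] := p * p.comp (X ^ N)
  have hq : aeval (s ^ N) q = aeval s q := by
    simp only [q, map_mul, aeval_comp_pow, hs'']
    rw [← aeval_comp_pow, ← map_mul, ← map_mul, mul_comm]
  have hc := isCompl_ker_range_aeval hsN hN q
  have horth := bilin_ker_range_eq_zero (B := B) (T := aeval s q) fun u v => by
    rw [bilin_aeval_left hs hss', hq]
  have hcW : ∀ g : Module.End F V, (∀ v, g (s v) = s (g v)) →
      ∀ u ∈ LinearMap.ker (aeval s q), g u ∈ LinearMap.ker (aeval s q) :=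
    fun g hg u hu => by
      rw [LinearMap.mem_ker] at *
      rw [← commute_aeval_apply hg, hu, map_zero]
  have hcR : ∀ g : Module.End F V, (∀ v, g (s v) = s (g v)) →
      ∀ u ∈ LinearMap.range (aeval s q), g u ∈ LinearMap.range (aeval s q) := by
    rintro g hg _ ⟨u, rfl⟩
    exact ⟨g u, (commute_aeval_apply hg q u).symm⟩
  generalize hW : LinearMap.ker (aeval s q) = W at hc horth hcW
  generalize LinearMap.range (aeval s q) = R at hc horth hcR
  have hpow : ∀ (Y : Submodule F V) (h : ∀ u ∈ Y, s u ∈ Y), s.restrict h ^ (N + 1) = 1 :=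
    fun Y h => LinearMap.ext fun u => Subtype.ext (by rw [Module.End.pow_restrict]; simp [hsN])
  have hWnt : Nontrivial W := by
    rw [Submodule.nontrivial_iff_ne_bot, ← hW]
    refine fun h => hker (le_bot_iff.1 (h ▸ fun v hv => ?_))
    simp only [q]
    rw [LinearMap.mem_ker] at *
    rw [mul_comm, map_mul, Module.End.mul_apply, hv, map_zero]
  obtain ⟨α, a, k, ha, hk, hak, ⟨φ⟩⟩ := exists_mulEquiv_GLsign hf hF (B.domRestrict₁₂ W W)
    (fun u v => hsymm u v) (restrict_nondegenerate_of_isCompl hB hc horth)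
    (s := s.restrict (hcW s fun _ => rfl)) (fun u v => hs u v) (hpow _ _) hN hp
    (fun v => Subtype.ext (by
      rw [← aeval_comp_pow, ← Module.End.mul_apply, ← map_mul, restrict_aeval_apply]
      exact LinearMap.mem_ker.1 (hW.ge v.2)))
    fun v hv => Subtype.ext (hfix v (congrArg Subtype.val hv))
  have hdim := Submodule.finrank_add_eq_of_isCompl hc
  have hWpos : 0 < Module.finrank F W := Module.finrank_pos
  obtain ⟨t, a', κ', α', ha', hκ', hsum, ⟨ψ⟩⟩ := ih _ (by omega) (B.domRestrict₁₂ R R)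
    (fun u v => hsymm u v)
    (restrict_nondegenerate_of_isCompl hB hc.symm fun u hu v hv =>
      (hsymm u v).trans (horth v hv u hu))
    (s := s.restrict (hcR s fun _ => rfl)) (fun u v => hs u v) (hpow _ _)
    (fun v hv => Subtype.ext (hfix v (congrArg Subtype.val hv))) rfl
  obtain ⟨χ⟩ := nonempty_bilinCentralizer_mulEquiv_prod hsymm hc horth hcW hcR
  refine ⟨t + 1, Fin.cons a a', Fin.cons k κ', Fin.cons α α', Fin.cases ha ha',
    Fin.cases hk hκ', ?_, ⟨(χ.trans (φ.prodCongr ψ)).trans (finConsMulEquiv fun i : Fin (t + 1) =>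
      GLsign 2 ((Fin.cons α α' : Fin (t + 1) → Bool) i) ((Fin.cons a a' : Fin (t + 1) → ℕ) i)
        (f * (Fin.cons k κ' : Fin (t + 1) → ℕ) i))⟩⟩
  rw [Fin.sum_univ_succ]
  simp only [Fin.cons_zero, Fin.cons_succ]
  rw [← hdim, hak, hsum, mul_add]

end FixedPointFree

section QuadraticCentralizers

open Polynomial

variable {F V : Type} [Field F] [AddCommGroup V] [Module F V]

theorem glToEnd_equivFun_symm {m : ℕ} (b : Module.Basis (Fin m) F V) (A : GL (Fin m) F)
    (x : Fin m → F) :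
    glToEnd (F := F) b (RingEquiv.refl F) A (b.equivFun.symm x) =
      b.equivFun.symm (A.1 *ᵥ x) := by
  rw [glToEnd_apply, ← LinearEquiv.symm_apply_eq, LinearEquiv.symm_symm]
  ext i
  rw [Module.Basis.equivFun_apply, Matrix.repr_toLin, ← Module.Basis.equivFun_apply,
    LinearEquiv.apply_symm_apply]
  rfl

theorem injective_of_mem_quadCentralizer {Q : QuadraticForm F V}
    (hQ : ∀ v, (∀ w, QuadraticMap.polar Q v w = 0) → v = 0) {s g : Module.End F V}
    (hg : g ∈ quadCentralizer Q s) : Function.Injective g := by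
  refine (injective_iff_map_eq_zero g).2 fun v hv => hQ v fun w => ?_
  have h : QuadraticMap.polar Q (g v) (g w) = QuadraticMap.polar Q v w := by
    simp only [QuadraticMap.polar, ← map_add, hg.1]
  rw [← h, hv, QuadraticMap.polar_zero_left]

/-- The matrix description of the centralizer of `s` in the isometry group of `Q`. -/
theorem nonempty_quadCentralizer_mulEquiv {m : ℕ} {Q : QuadraticForm F V}
    (hQ : ∀ v, (∀ w, QuadraticMap.polar Q v w = 0) → v = 0) (b : Module.Basis (Fin m) F V)
    (s : GL (Fin m) F) :
    Nonempty (quadCentralizer Q (glToEnd (F := F) b (RingEquiv.refl F) s) ≃*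
      ↥(Subgroup.centralizer {s} ⊓ isomGroup (Q.comp b.equivFun.symm.toLinearMap))) := by
  let φ := glToEnd (F := F) b (RingEquiv.refl F)
  have hφ : Function.Injective φ := glToEnd_injective b _
  have key : ∀ A, φ A ∈ quadCentralizer Q (φ s) ↔
      A ∈ Subgroup.centralizer {s} ⊓ isomGroup (Q.comp b.equivFun.symm.toLinearMap) := by
    intro A
    rw [mem_quadCentralizer, Subgroup.mem_inf, and_comm, Subgroup.mem_centralizer_singleton_iff]
    refine and_congr ⟨fun h => hφ ?_, fun h v => ?_⟩ ⟨fun h x => ?_, fun h v => ?_⟩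
    · rw [map_mul, map_mul]
      exact LinearMap.ext h
    · rw [← Module.End.mul_apply, ← Module.End.mul_apply, ← map_mul, ← map_mul, h]
    · change Q (b.equivFun.symm (A.1 *ᵥ x)) = Q (b.equivFun.symm x)
      rw [← glToEnd_equivFun_symm, h]
    · obtain ⟨x, rfl⟩ := b.equivFun.symm.surjective v
      change Q (glToEnd (F := F) b (RingEquiv.refl F) A _) = _
      rw [glToEnd_equivFun_symm]
      exact h x
  refine nonempty_mulEquiv_of_range (φ.comp (Subgroup.subtype _))
    (hφ.comp Subtype.val_injective) _ fun g => ⟨fun hg => ?_, ?_⟩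
  · obtain ⟨A, rfl⟩ := (exists_glToEnd_eq_iff b (RingEquiv.refl F) g).2
      ⟨injective_of_mem_quadCentralizer hQ hg, map_smul g⟩
    exact ⟨⟨A, (key A).1 hg⟩, rfl⟩
  · rintro ⟨A, rfl⟩
    exact (key A).2 A.2

/-- The centralizer of an isometry of `Q` is the product of the isometry group of its fixed space
with a centralizer preserving only the polar form. -/
theorem nonempty_quadCentralizer_mulEquiv_prod {Q : QuadraticForm F V} {s : Module.End F V}
    (hs : ∀ v, Q (s v) = Q v) {W R : Submodule F V} (hWR : IsCompl W R)
    (hW : W = LinearMap.ker (aeval s (X - 1 : F[X])))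
    (hR : R = LinearMap.range (aeval s (X - 1 : F[X])))
    (horth : ∀ u ∈ W, ∀ v ∈ R, polarForm Q u v = 0) (hsR : ∀ u ∈ R, s u ∈ R) :
    Nonempty (quadCentralizer Q s ≃* quadCentralizer (Q.comp W.subtype) 1 ×
      bilinCentralizer ((polarForm Q).domRestrict₁₂ R R) (s.restrict hsR : Module.End F R)) := by
  have hT : ∀ v, aeval s (X - 1 : F[X]) v = s v - v := fun v => by simp
  have hfix : ∀ u ∈ W, s u = u := fun u hu => by
    rw [hW, LinearMap.mem_ker, hT, sub_eq_zero] at hu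
    exact hu
  have hadd : ∀ u v, Q (u + v) = Q u + Q v + polarForm Q u v := fun u v => by
    rw [polarForm_apply, QuadraticMap.polar]
    ring
  have hdec : ∀ v : V, ∃ (u : W) (r : R), v = u + r := fun v => by
    obtain ⟨u, hu, r, hr, rfl⟩ := Submodule.mem_sup.1
      (show v ∈ W ⊔ R by rw [hWR.sup_eq_top]; trivial)
    exact ⟨⟨u, hu⟩, ⟨r, hr⟩, rfl⟩
  have hpolar : ∀ {s g : Module.End F V}, g ∈ quadCentralizer Q s →
      ∀ u v, polarForm Q (g u) (g v) = polarForm Q u v := fun hg u v => by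
    simp only [polarForm_apply, QuadraticMap.polar, ← map_add, hg.1]
  refine nonempty_mulEquiv_prod_of_isCompl hWR _ _ _ (fun g hg u hu => ?_)
    (fun g hg u hu => ?_) fun g hgW hgR => ⟨fun hg => ⟨⟨fun u => hg.1 u, fun v => rfl⟩,
      ⟨fun u v => hpolar hg u v, fun v => Subtype.ext (hg.2 v)⟩⟩, ?_⟩
  · rw [hW, LinearMap.mem_ker] at *
    rw [← commute_aeval_apply hg.2, hu, map_zero]
  · rw [hR] at *
    obtain ⟨v, rfl⟩ := hu
    exact ⟨g v, (commute_aeval_apply hg.2 _ v).symm⟩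
  rintro ⟨⟨h₁, -⟩, ⟨h₂, h₂'⟩⟩
  have hB : ∀ r t : R, polarForm Q (g r) (g t) = polarForm Q r t := fun r t => h₂ r t
  have hgs : ∀ r : R, g (s r) = s (g r) := fun r => congrArg Subtype.val (h₂' r)
  have hQR : ∀ r : R, Q (g r) = Q r := by
    rintro ⟨r, hr⟩
    obtain ⟨x, hx⟩ : ∃ x, aeval s (X - 1 : F[X]) x = r := by rwa [hR] at hr
    obtain ⟨u, t, rfl⟩ := hdec x
    rw [map_add, hT, hfix u u.2, sub_self, zero_add, hT] at hx
    have h₃ : s t = t + r := by rw [← hx]; abel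
    have h₄ := hs (g t)
    rw [← hgs, h₃, map_add, hadd, hB t ⟨r, hr⟩] at h₄
    have h₅ := hs t
    rw [h₃, hadd] at h₅
    change Q (g r) = Q r
    linear_combination h₄ - h₅
  refine ⟨fun v => ?_, fun v => ?_⟩
  · obtain ⟨u, r, rfl⟩ := hdec v
    rw [map_add, hadd, hadd, horth _ (hgW u u.2) _ (hgR r r.2), horth u u.2 r r.2, hQR,
      show Q (g u) = Q u from h₁ u]
  · obtain ⟨u, r, rfl⟩ := hdec v
    rw [map_add, map_add, map_add, map_add, hgs, hfix u u.2, hfix _ (hgW u u.2)]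

end QuadraticCentralizers

/-- Lemma 2.3: for `q = 2^f` and a semisimple element `s` of `O^ε_(2n)(q)` (the isometry
group of a nondegenerate quadratic form `Q` on `F_q^(2n)` of Witt index `n` or `n - 1`), the
centralizer of `s` in `O^ε_(2n)(q)` is isomorphic to
`O^(ε')_(2m)(q) × ∏ᵢ GL^(αᵢ)_(aᵢ)(q^(kᵢ))` with `Σᵢ kᵢ aᵢ = n - m`. -/
theorem o_even_char_semisimple_centralizer (f n : ℕ) (hf : 0 < f)
    (F : Type) [Field F] [Fintype F] (hF : Fintype.card F = 2 ^ f) (ε : Bool)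
    (Q : QuadraticForm F (Fin (2 * n) → F)) (hQ : IsNondegQF Q)
    (hW : HasWittIndex Q (if ε then n else n - 1))
    (s : GL (Fin (2 * n)) F) (hs : s ∈ isomGroup Q)
    (hss : (orderOf s).Coprime 2) :
    ∃ (m t : ℕ) (a κ : Fin t → ℕ) (α : Fin t → Bool) (ε' : Bool),
      m ≤ n ∧ (∀ i, 0 < a i) ∧ (∀ i, 0 < κ i) ∧ (∑ i, κ i * a i) = n - m ∧
      ∃ Q' : QuadraticForm F (Fin (2 * m) → F),
        IsNondegQF Q' ∧ HasWittIndex Q' (if ε' then m else m - 1) ∧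
        Nonempty ((↥(Subgroup.centralizer {s} ⊓ isomGroup Q)) ≃*
          (↥(isomGroup Q') × ((i : Fin t) → GLsign 2 (α i) (a i) (f * κ i)))) := by
  have hchar : CharP F 2 := by
    obtain ⟨p, hp⟩ := CharP.exists F
    have hp' := CharP.char_is_prime F p
    obtain ⟨k, hk, hk'⟩ := FiniteField.card F p
    have h1 : p ∣ 2 ^ f := by
      rw [← hF, hk']
      exact dvd_pow_self p k.ne_zero
    have := (Nat.prime_dvd_prime_iff_eq hk Nat.prime_two).1 (hk.dvd_of_dvd_pow h1)
    exact this ▸ hp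
  have hnd := polar_nondegenerate_of_even_finrank Q (by simp) hQ
  let b := Pi.basisFun F (Fin (2 * n))
  let S := glToEnd (F := F) b (RingEquiv.refl F) s
  have hb : Q.comp b.equivFun.symm.toLinearMap = Q := by
    ext v
    change Q (b.equivFun.symm v) = Q v
    congr 1
  obtain ⟨φ⟩ := nonempty_quadCentralizer_mulEquiv hnd b s
  rw [hb] at φ
  have hS : ∀ v, Q (S v) = Q v := fun v => by
    have h : S v = s.1 *ᵥ v := glToEnd_equivFun_symm b s v
    rw [h]
    exact hs v
  obtain ⟨N, hN⟩ := Nat.exists_eq_add_of_le' (orderOf_pos s)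
  have hSN : S ^ (N + 1) = 1 := by rw [← map_pow, ← hN, pow_orderOf_eq_one, map_one]
  have hcop : (Fintype.card F).Coprime (N + 1) := by
    rw [hF, ← hN]
    exact (Nat.Coprime.pow_left f hss.symm)
  have hB : ∀ u v, polarForm Q (S u) (S v) = polarForm Q u v := fun u v => by
    simp only [polarForm_apply, QuadraticMap.polar, ← map_add, hS]
  have hsymm : ∀ u v, polarForm Q u v = polarForm Q v u := QuadraticMap.polar_comm Q
  have hT : ∀ v, Polynomial.aeval S (Polynomial.X - 1 : Polynomial F) v = S v - v :=
    fun v => by simp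
  have hc := isCompl_ker_range_aeval hSN hcop (Polynomial.X - 1)
  generalize hW₁ : LinearMap.ker (Polynomial.aeval S (Polynomial.X - 1 : Polynomial F)) = W at hc
  generalize hR₁ : LinearMap.range (Polynomial.aeval S (Polynomial.X - 1 : Polynomial F)) = R at hc
  have horth : ∀ u ∈ W, ∀ v ∈ R, polarForm Q u v = 0 := by
    intro u hu v hv
    rw [← hW₁, LinearMap.mem_ker, hT, sub_eq_zero] at hu
    rw [← hR₁] at hv
    obtain ⟨x, rfl⟩ := hv
    rw [hT, map_sub, sub_eq_zero, ← hB u x, hu]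
  have hSR : ∀ u ∈ R, S u ∈ R := by
    rw [← hR₁]
    rintro _ ⟨u, rfl⟩
    exact ⟨S u, (commute_aeval_apply (fun _ => rfl) _ u).symm⟩
  obtain ⟨ψ⟩ := nonempty_quadCentralizer_mulEquiv_prod hS hc hW₁.symm hR₁.symm horth hSR
  obtain ⟨t, a, κ, α, ha, hκ, hsum, ⟨χ⟩⟩ := exists_mulEquiv_pi_GLsign hf hF
    ((polarForm Q).domRestrict₁₂ R R) (fun u v => hsymm u v)
    (restrict_nondegenerate_of_isCompl hnd hc.symm fun u hu v hv =>
      (hsymm u v).trans (horth v hv u hu))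
    (s := S.restrict hSR) (fun u v => hB u v)
    (LinearMap.ext fun u => Subtype.ext (by rw [Module.End.pow_restrict]; simp [hSN])) hcop
    fun v hv => Subtype.ext (Submodule.disjoint_def.1 hc.disjoint v
      (by
        rw [← hW₁, LinearMap.mem_ker, hT, sub_eq_zero]
        exact congrArg Subtype.val hv) v.2)
  have hdim := Submodule.finrank_add_eq_of_isCompl hc
  rw [hsum, Module.finrank_fin_fun] at hdim
  obtain ⟨m, hm⟩ : ∃ m, n = m + ∑ i, κ i * a i := Nat.exists_eq_add_of_le' (by omega)
  have hWnd : ∀ v : W, (∀ w, QuadraticMap.polar (Q.comp W.subtype) v w = 0) → v = 0 :=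
    restrict_nondegenerate_of_isCompl hnd hc horth
  let b₁ := Module.finBasisOfFinrankEq F W (n := 2 * m) (by omega)
  let Q' : QuadraticForm F (Fin (2 * m) → F) :=
    (Q.comp W.subtype).comp b₁.equivFun.symm.toLinearMap
  have hQ' : ∀ v, (∀ w, QuadraticMap.polar Q' v w = 0) → v = 0 := fun v hv => by
    refine b₁.equivFun.symm.map_eq_zero_iff.1 (hWnd _ fun w => ?_)
    obtain ⟨w, rfl⟩ := b₁.equivFun.symm.surjective w
    have h := hv w
    simp only [QuadraticMap.polar, Q', QuadraticMap.comp_apply, map_add] at h ⊢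
    exact h
  obtain ⟨ε', hε'⟩ := exists_hasWittIndex Q' hQ'
  obtain ⟨ω⟩ := nonempty_quadCentralizer_mulEquiv hWnd b₁ 1
  rw [map_one] at ω
  have htop : Subgroup.centralizer {(1 : GL (Fin (2 * m)) F)} ⊓ isomGroup Q' = isomGroup Q' :=
    inf_eq_right.2 fun g _ => Subgroup.mem_centralizer_singleton_iff.2 (by simp)
  exact ⟨m, t, a, κ, α, ε', by omega, ha, hκ, by omega, Q', fun v hv _ => hQ' v hv, hε',
    ⟨φ.symm.trans (ψ.trans ((ω.trans (MulEquiv.subgroupCongr htop)).prodCongr χ))⟩⟩
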